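/- arXiv:2409.10861 — 5 statements merged into one kernel-verified Lean document; each statement's English description precedes it below -/
import Mathlib

section
/- Let b > 0, 0 ≤ μ < 1, γ > 0 with μ + γ ≥ 1, ε ∈ (0,1], y₀ ∈ ℝ. Let p₁, q₁ be continuous on [0,b], g₁ continuous on [0,b], and K₁, K₂ continuous on the triangle {(t,s) : 0 ≤ s ≤ t ≤ b}; set A = max|p₁|, Q = max|q₁|, K̄ᵢ = max|Kᵢ|. Define the map δ sending a continuous v : [0,b] → ℝ to δ(v)(t) = y₀ + ∫₀^t (p₁(s) v(s) + q₁(s) v(εs) + g₁(s)) ds + ∫₀^t ∫₀^1 (1−ξ)^{−μ} ξ^{μ+γ−1} K₁(s, sξ) v(sξ) dξ ds + ∫₀^t ∫₀^1 (1−ξ)^{−μ} ξ^{μ+γ−1} K₂(s, εsξ) v(εsξ) dξ ds. Then for all continuous v₁, v₂ : [0,b] → ℝ, sup_{[0,b]} |δ(v₁) − δ(v₂)| ≤ b (A + Q + (K̄₁ + K̄₂) B(1−μ, μ+γ)) · sup_{[0,b]} |v₁ − v₂|. In particular, if b (A + Q + (K̄₁ + K̄₂) B(1−μ, μ+γ))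 < 1, then δ is a contraction in the supremum norm. -/
open Set MeasureTheory intervalIntegral

/-- The real Beta function `B(x, y) = ∫₀¹ s^(x-1) (1-s)^(y-1) ds`. -/
noncomputable def betaFn (x y : ℝ) : ℝ :=
  ∫ s in (0:ℝ)..1, s ^ (x - 1) * (1 - s) ^ (y - 1)

lemma aux_w_int (μ γ : ℝ) (hμ1 : μ < 1) (hμγ : 1 ≤ μ + γ) :
    IntervalIntegrable (fun ξ : ℝ => (1 - ξ) ^ (-μ) * ξ ^ (μ + γ - 1)) volume 0 1 := by
  have h1 : IntervalIntegrable (fun ξ : ℝ => (1 - ξ) ^ (-μ)) volume 0 1 := by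
    have h := (intervalIntegral.intervalIntegrable_rpow' (a := 0) (b := 1) (r := -μ) (by linarith)).comp_sub_left 1
    simpa using h.symm
  refine h1.mul_continuousOn ?_
  exact (Real.continuous_rpow_const (by linarith)).continuousOn

lemma aux_w_beta (μ γ : ℝ) :
    ∫ ξ in (0:ℝ)..1, (1 - ξ) ^ (-μ) * ξ ^ (μ + γ - 1) = betaFn (1 - μ) (μ + γ) := by
  unfold betaFn
  have h := intervalIntegral.integral_comp_sub_left (a := 0) (b := 1)
    (fun s : ℝ => s ^ (1 - μ - 1) * (1 - s) ^ (μ + γ - 1)) 1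
  simp only [sub_zero, sub_self] at h
  rw [← h]
  congr 1
  ext ξ
  rw [show 1 - μ - 1 = -μ by ring, show 1 - (1 - ξ) = ξ by ring]

lemma aux_cont (b : ℝ) (w : ℝ → ℝ) (hw : IntervalIntegrable w volume 0 1)
    (h : ℝ × ℝ → ℝ) (hh : ContinuousOn h (Icc 0 b ×ˢ Icc 0 1)) :
    ContinuousOn (fun s => ∫ ξ in (0:ℝ)..1, w ξ * h (s, ξ)) (Icc 0 b) ∧
    ∀ s ∈ Icc 0 b, IntervalIntegrable (fun ξ => w ξ * h (s, ξ)) volume 0 1 := by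
  have hint : ∀ s ∈ Icc 0 b, IntervalIntegrable (fun ξ => w ξ * h (s, ξ)) volume 0 1 := by
    intro s hs
    refine hw.mul_continuousOn ?_
    rw [uIcc_of_le zero_le_one]
    exact hh.comp (by fun_prop) (fun ξ hξ => ⟨hs, hξ⟩)
  refine ⟨?_, hint⟩
  obtain ⟨C, hC⟩ := (isCompact_Icc.prod isCompact_Icc).exists_bound_of_continuousOn hh
  intro s hs
  refine intervalIntegral.continuousWithinAt_of_dominated_interval
    (bound := fun ξ => |w ξ| * C) ?_ ?_ ?_ ?_
  · filter_upwards [self_mem_nhdsWithin] with x hx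
    exact (hint x hx).def'.aestronglyMeasurable
  · filter_upwards [self_mem_nhdsWithin] with x hx
    refine Filter.Eventually.of_forall fun ξ hξ => ?_
    rw [uIoc_of_le zero_le_one] at hξ
    rw [norm_mul, Real.norm_eq_abs (w ξ)]
    exact mul_le_mul_of_nonneg_left (hC (x, ξ) ⟨hx, hξ.1.le, hξ.2⟩) (abs_nonneg _)
  · exact hw.abs.mul_const C
  · refine Filter.Eventually.of_forall fun ξ hξ => ?_
    rw [uIoc_of_le zero_le_one] at hξ
    have : ContinuousOn (fun s => h (s, ξ)) (Icc 0 b) :=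
      hh.comp (by fun_prop) (fun x hx => ⟨hx, hξ.1.le, hξ.2⟩)
    exact continuousWithinAt_const.mul (this s hs)

lemma aux_single (b : ℝ) (D : ℝ) (f₁ f₂ : ℝ → ℝ)
    (h₁ : ContinuousOn f₁ (Icc 0 b)) (h₂ : ContinuousOn f₂ (Icc 0 b))
    (hD : ∀ s ∈ Icc 0 b, |f₁ s - f₂ s| ≤ D) (t : ℝ) (ht : t ∈ Icc 0 b) :
    |(∫ s in (0:ℝ)..t, f₁ s) - ∫ s in (0:ℝ)..t, f₂ s| ≤ b * D := by
  have hsub : uIcc 0 t ⊆ Icc 0 b := by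
    rw [uIcc_of_le ht.1]; exact Icc_subset_Icc_right ht.2
  rw [← intervalIntegral.integral_sub (h₁.mono hsub).intervalIntegrable
    (h₂.mono hsub).intervalIntegrable]
  have := intervalIntegral.norm_integral_le_of_norm_le_const (a := 0) (b := t) (C := D)
    (f := fun s => f₁ s - f₂ s) (fun s hs => hD s (hsub (uIoc_subset_uIcc hs)))
  rw [Real.norm_eq_abs, sub_zero, abs_of_nonneg ht.1] at this
  have hD0 : 0 ≤ D := (abs_nonneg _).trans (hD t ht)
  nlinarith [mul_le_mul_of_nonneg_right ht.2 hD0]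

lemma aux_double (b : ℝ) (w : ℝ → ℝ) (hw : IntervalIntegrable w volume 0 1)
    (hw0 : ∀ ξ ∈ Icc (0:ℝ) 1, 0 ≤ w ξ) (D : ℝ)
    (h₁ h₂ : ℝ × ℝ → ℝ) (hh₁ : ContinuousOn h₁ (Icc 0 b ×ˢ Icc 0 1))
    (hh₂ : ContinuousOn h₂ (Icc 0 b ×ˢ Icc 0 1))
    (hD : ∀ s ∈ Icc 0 b, ∀ ξ ∈ Icc (0:ℝ) 1, |h₁ (s, ξ) - h₂ (s, ξ)| ≤ D)
    (t : ℝ) (ht : t ∈ Icc 0 b) :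
    |(∫ s in (0:ℝ)..t, ∫ ξ in (0:ℝ)..1, w ξ * h₁ (s, ξ))
      - ∫ s in (0:ℝ)..t, ∫ ξ in (0:ℝ)..1, w ξ * h₂ (s, ξ)|
      ≤ b * ((∫ ξ in (0:ℝ)..1, w ξ) * D) := by
  obtain ⟨c₁, i₁⟩ := aux_cont b w hw h₁ hh₁
  obtain ⟨c₂, i₂⟩ := aux_cont b w hw h₂ hh₂
  refine aux_single b _ _ _ c₁ c₂ ?_ t ht
  intro s hs
  rw [← intervalIntegral.integral_sub (i₁ s hs) (i₂ s hs), ← Real.norm_eq_abs,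
    ← intervalIntegral.integral_mul_const]
  refine intervalIntegral.norm_integral_le_of_norm_le zero_le_one ?_ (hw.mul_const D)
  refine Filter.Eventually.of_forall fun ξ hξ => ?_
  have hξ' : ξ ∈ Icc (0:ℝ) 1 := ⟨hξ.1.le, hξ.2⟩
  rw [← mul_sub, norm_mul, Real.norm_eq_abs, Real.norm_eq_abs, abs_of_nonneg (hw0 ξ hξ')]
  exact mul_le_mul_of_nonneg_left (hD s hs ξ hξ') (hw0 ξ hξ')

lemma aux_kernel (b μ γ ε : ℝ) (hμ1 : μ < 1)
    (hμγ : 1 ≤ μ + γ) (hε0 : 0 < ε) (hε1 : ε ≤ 1) (K : ℝ → ℝ → ℝ)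
    (hK : ContinuousOn (fun p : ℝ × ℝ => K p.1 p.2)
      {p : ℝ × ℝ | 0 ≤ p.2 ∧ p.2 ≤ p.1 ∧ p.1 ≤ b})
    (Kb : ℝ)
    (hKb : IsGreatest ((fun p : ℝ × ℝ => |K p.1 p.2|) ''
      {p : ℝ × ℝ | 0 ≤ p.2 ∧ p.2 ≤ p.1 ∧ p.1 ≤ b}) Kb)
    (v₁ v₂ : ℝ → ℝ)
    (hv₁ : ContinuousOn v₁ (Icc 0 b)) (hv₂ : ContinuousOn v₂ (Icc 0 b))
    (M : ℝ) (hM : IsGreatest ((fun t => |v₁ t - v₂ t|) '' Icc 0 b) M)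
    (t : ℝ) (ht : t ∈ Icc 0 b) :
    |(∫ s in (0:ℝ)..t, ∫ ξ in (0:ℝ)..1,
          (1 - ξ) ^ (-μ) * ξ ^ (μ + γ - 1) * K s (ε * s * ξ) * v₁ (ε * s * ξ))
      - ∫ s in (0:ℝ)..t, ∫ ξ in (0:ℝ)..1,
          (1 - ξ) ^ (-μ) * ξ ^ (μ + γ - 1) * K s (ε * s * ξ) * v₂ (ε * s * ξ)|
      ≤ b * (betaFn (1 - μ) (μ + γ) * (Kb * M)) := by
  have hmem : ∀ s ∈ Icc 0 b, ∀ ξ ∈ Icc (0:ℝ) 1, 0 ≤ ε * s * ξ ∧ ε * s * ξ ≤ s ∧ s ≤ b := by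
    intro s hs ξ hξ
    have h0 : 0 ≤ ε * s := mul_nonneg hε0.le hs.1
    refine ⟨mul_nonneg h0 hξ.1, ?_, hs.2⟩
    exact (mul_le_of_le_one_right h0 hξ.2).trans (mul_le_of_le_one_left hs.1 hε1)
  have hc : ∀ v : ℝ → ℝ, ContinuousOn v (Icc 0 b) → ContinuousOn
      (fun p : ℝ × ℝ => K p.1 (ε * p.1 * p.2) * v (ε * p.1 * p.2)) (Icc 0 b ×ˢ Icc 0 1) := by
    intro v hv
    refine ContinuousOn.mul ?_ ?_
    · exact hK.comp (f := fun p : ℝ × ℝ => (p.1, ε * p.1 * p.2)) (by fun_prop)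
        (fun p hp => hmem p.1 hp.1 p.2 hp.2)
    · refine hv.comp (by fun_prop) (fun p hp => ?_)
      have := hmem p.1 hp.1 p.2 hp.2
      exact ⟨this.1, this.2.1.trans this.2.2⟩
  have key := aux_double b _ (aux_w_int μ γ hμ1 hμγ)
    (fun ξ hξ => mul_nonneg (Real.rpow_nonneg (by linarith [hξ.2]) _)
      (Real.rpow_nonneg hξ.1 _)) (Kb * M) _ _ (hc v₁ hv₁) (hc v₂ hv₂) ?_ t ht
  · rw [aux_w_beta] at key
    simpa only [mul_assoc] using key
  · intro s hs ξ hξ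
    have h := hmem s hs ξ hξ
    rw [← mul_sub, abs_mul]
    have h1 : |K s (ε * s * ξ)| ≤ Kb := hKb.2 ⟨(s, ε * s * ξ), h, rfl⟩
    exact mul_le_mul h1 (hM.2 ⟨_, ⟨h.1, h.2.1.trans h.2.2⟩, rfl⟩) (abs_nonneg _)
      ((abs_nonneg _).trans h1)

/-- Contraction estimate for the Picard-type integral map `δ` in the existence proof
for the delayed cordial Volterra integro-differential equation:
`sup |δ(v₁) − δ(v₂)| ≤ b (A + Q + (K̄₁ + K̄₂) B(1−μ, μ+γ)) · sup |v₁ − v₂|`.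
In particular, if `b (A + Q + (K̄₁ + K̄₂) B(1−μ, μ+γ)) < 1`, then `δ` is a
contraction in the supremum norm. -/
theorem picard_map_contraction
    (b μ γ ε y₀ : ℝ) (hb : 0 < b) (hμ0 : 0 ≤ μ) (hμ1 : μ < 1)
    (hγ : 0 < γ) (hμγ : 1 ≤ μ + γ) (hε0 : 0 < ε) (hε1 : ε ≤ 1)
    (p₁ q₁ g₁ : ℝ → ℝ) (K₁ K₂ : ℝ → ℝ → ℝ)
    (hp : ContinuousOn p₁ (Icc 0 b)) (hq : ContinuousOn q₁ (Icc 0 b))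
    (hg : ContinuousOn g₁ (Icc 0 b))
    (hK₁ : ContinuousOn (fun p : ℝ × ℝ => K₁ p.1 p.2)
      {p : ℝ × ℝ | 0 ≤ p.2 ∧ p.2 ≤ p.1 ∧ p.1 ≤ b})
    (hK₂ : ContinuousOn (fun p : ℝ × ℝ => K₂ p.1 p.2)
      {p : ℝ × ℝ | 0 ≤ p.2 ∧ p.2 ≤ p.1 ∧ p.1 ≤ b})
    (A Q Kb₁ Kb₂ : ℝ)
    (hA : IsGreatest ((fun t => |p₁ t|) '' Icc 0 b) A)
    (hQ : IsGreatest ((fun t => |q₁ t|) '' Icc 0 b) Q)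
    (hKb₁ : IsGreatest ((fun p : ℝ × ℝ => |K₁ p.1 p.2|) ''
      {p : ℝ × ℝ | 0 ≤ p.2 ∧ p.2 ≤ p.1 ∧ p.1 ≤ b}) Kb₁)
    (hKb₂ : IsGreatest ((fun p : ℝ × ℝ => |K₂ p.1 p.2|) ''
      {p : ℝ × ℝ | 0 ≤ p.2 ∧ p.2 ≤ p.1 ∧ p.1 ≤ b}) Kb₂)
    (v₁ v₂ : ℝ → ℝ)
    (hv₁ : ContinuousOn v₁ (Icc 0 b)) (hv₂ : ContinuousOn v₂ (Icc 0 b))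
    (M : ℝ) (hM : IsGreatest ((fun t => |v₁ t - v₂ t|) '' Icc 0 b) M)
    (y₁ y₂ : ℝ → ℝ)
    (hy₁ : ∀ t, y₁ t = y₀
      + (∫ s in (0:ℝ)..t, (p₁ s * v₁ s + q₁ s * v₁ (ε * s) + g₁ s))
      + (∫ s in (0:ℝ)..t, ∫ ξ in (0:ℝ)..1,
          (1 - ξ) ^ (-μ) * ξ ^ (μ + γ - 1) * K₁ s (s * ξ) * v₁ (s * ξ))
      + (∫ s in (0:ℝ)..t, ∫ ξ in (0:ℝ)..1,
          (1 - ξ) ^ (-μ) * ξ ^ (μ + γ - 1) * K₂ s (ε * s * ξ) * v₁ (ε * s * ξ)))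
    (hy₂ : ∀ t, y₂ t = y₀
      + (∫ s in (0:ℝ)..t, (p₁ s * v₂ s + q₁ s * v₂ (ε * s) + g₁ s))
      + (∫ s in (0:ℝ)..t, ∫ ξ in (0:ℝ)..1,
          (1 - ξ) ^ (-μ) * ξ ^ (μ + γ - 1) * K₁ s (s * ξ) * v₂ (s * ξ))
      + (∫ s in (0:ℝ)..t, ∫ ξ in (0:ℝ)..1,
          (1 - ξ) ^ (-μ) * ξ ^ (μ + γ - 1) * K₂ s (ε * s * ξ) * v₂ (ε * s * ξ))) :
    ∀ t ∈ Icc (0:ℝ) b,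
      |y₁ t - y₂ t| ≤ b * (A + Q + (Kb₁ + Kb₂) * betaFn (1 - μ) (μ + γ)) * M := by
  intro t ht
  have e : ∀ s ∈ Icc 0 b, ε * s ∈ Icc 0 b := fun s hs =>
    ⟨mul_nonneg hε0.le hs.1, (mul_le_of_le_one_left hs.1 hε1).trans hs.2⟩
  have hc : ∀ v : ℝ → ℝ, ContinuousOn v (Icc 0 b) → ContinuousOn
      (fun s => p₁ s * v s + q₁ s * v (ε * s) + g₁ s) (Icc 0 b) := fun v hv =>
    ((hp.mul hv).add (hq.mul (hv.comp (by fun_prop) e))).add hg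
  have E1 := aux_single b (A * M + Q * M) _ _ (hc v₁ hv₁) (hc v₂ hv₂) (by
    intro s hs
    have a1 : |p₁ s| ≤ A := hA.2 ⟨s, hs, rfl⟩
    have a2 : |q₁ s| ≤ Q := hQ.2 ⟨s, hs, rfl⟩
    have m1 : |v₁ s - v₂ s| ≤ M := hM.2 ⟨s, hs, rfl⟩
    have m2 : |v₁ (ε * s) - v₂ (ε * s)| ≤ M := hM.2 ⟨_, e s hs, rfl⟩
    rw [show p₁ s * v₁ s + q₁ s * v₁ (ε * s) + g₁ s - (p₁ s * v₂ s + q₁ s * v₂ (ε * s) + g₁ s)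
      = p₁ s * (v₁ s - v₂ s) + q₁ s * (v₁ (ε * s) - v₂ (ε * s)) by ring]
    refine (abs_add_le _ _).trans (add_le_add ?_ ?_)
    · rw [abs_mul]
      exact mul_le_mul a1 m1 (abs_nonneg _) ((abs_nonneg _).trans a1)
    · rw [abs_mul]
      exact mul_le_mul a2 m2 (abs_nonneg _) ((abs_nonneg _).trans a2)) t ht
  have E2 := aux_kernel b μ γ 1 hμ1 hμγ one_pos le_rfl K₁ hK₁ Kb₁ hKb₁ v₁ v₂ hv₁ hv₂ M hM t ht
  have E3 := aux_kernel b μ γ ε hμ1 hμγ hε0 hε1 K₂ hK₂ Kb₂ hKb₂ v₁ v₂ hv₁ hv₂ M hM t ht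
  simp only [one_mul] at E2
  rw [hy₁, hy₂]
  rw [abs_le] at E1 E2 E3 ⊢
  constructor <;> linarith [E1.1, E1.2, E2.1, E2.2, E3.1, E3.2]
end

section
/- Let T > 0, 0 ≤ μ < 1, γ > 0 with μ + γ ≥ 1, ε ∈ (0,1], and j ∈ ℕ. Suppose K is j times continuously differentiable on the triangle D = {(t,s) : 0 ≤ s ≤ t ≤ T} (i.e. extends to a C^j function on an open set containing D) and y : [0,T] → ℝ is j times continuously differentiable. Then the function G(t) = ∫₀^1 (1−ξ)^{−μ} ξ^{μ+γ−1} K(t, εtξ) y(εtξ) dξ is j times continuously differentiable on [0,T], and for every t ∈ (0,T], G(t) = (εt)^{−γ} ∫₀^{εt} (εt−τ)^{−μ} τ^{μ+γ−1} K(t,τ) y(τ) dτ. In particular the cordial operator maps C^j[0,T] into C^j[0,T]. -/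
open Set MeasureTheory intervalIntegral Filter Topology

lemma cord_bdd (T : ℝ) (φ : ℝ → ℝ → ℝ)
    (hφ : ContinuousOn (fun p : ℝ × ℝ => φ p.1 p.2) (Icc 0 T ×ˢ Icc (0:ℝ) 1)) :
    ∃ C : ℝ, ∀ t ∈ Icc 0 T, ∀ ξ ∈ Icc (0:ℝ) 1, ‖φ t ξ‖ ≤ C := by
  obtain ⟨C, hC⟩ := (isCompact_Icc.prod isCompact_Icc).exists_bound_of_continuousOn hφ
  exact ⟨C, fun t ht ξ hξ => hC (t, ξ) ⟨ht, hξ⟩⟩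

lemma cord_int (T : ℝ) (w : ℝ → ℝ) (hw : IntervalIntegrable w volume 0 1) (φ : ℝ → ℝ → ℝ)
    (hφ : ContinuousOn (fun p : ℝ × ℝ => φ p.1 p.2) (Icc 0 T ×ˢ Icc (0:ℝ) 1))
    {t : ℝ} (ht : t ∈ Icc 0 T) :
    IntervalIntegrable (fun ξ => w ξ * φ t ξ) volume 0 1 := by
  apply hw.mul_continuousOn
  rw [uIcc_of_le zero_le_one]
  exact hφ.comp (f := fun ξ : ℝ => (t, ξ)) (by fun_prop) (fun ξ hξ => ⟨ht, hξ⟩)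

lemma cord_cont (T : ℝ) (w : ℝ → ℝ) (hw : IntervalIntegrable w volume 0 1) (φ : ℝ → ℝ → ℝ)
    (hφ : ContinuousOn (fun p : ℝ × ℝ => φ p.1 p.2) (Icc 0 T ×ˢ Icc (0:ℝ) 1)) :
    ContinuousOn (fun t => ∫ ξ in (0:ℝ)..1, w ξ * φ t ξ) (Icc 0 T) := by
  obtain ⟨C, hC⟩ := cord_bdd T φ hφ
  intro t ht
  have hsub : ∀ ξ : ℝ, ξ ∈ Set.uIoc (0:ℝ) 1 → ξ ∈ Icc (0:ℝ) 1 := fun ξ hξ => by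
    rw [uIoc_of_le zero_le_one] at hξ; exact Ioc_subset_Icc_self hξ
  apply intervalIntegral.tendsto_integral_filter_of_dominated_convergence (fun ξ => ‖w ξ‖ * C)
  · filter_upwards [self_mem_nhdsWithin] with s hs
    exact (cord_int T w hw φ hφ hs).def'.aestronglyMeasurable
  · filter_upwards [self_mem_nhdsWithin] with s hs
    refine Eventually.of_forall fun ξ hξ => ?_
    rw [norm_mul]
    exact mul_le_mul_of_nonneg_left (hC s hs ξ (hsub ξ hξ)) (norm_nonneg _)
  · exact hw.norm.mul_const C
  · refine Eventually.of_forall fun ξ hξ => ?_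
    have h : ContinuousOn (fun s => φ s ξ) (Icc 0 T) :=
      hφ.comp (f := fun s : ℝ => (s, ξ)) (by fun_prop) (fun s hs => ⟨hs, hsub ξ hξ⟩)
    exact (h t ht).tendsto.const_mul _

lemma cord_deriv (T : ℝ) (w : ℝ → ℝ) (hw : IntervalIntegrable w volume 0 1) (φ φ' : ℝ → ℝ → ℝ)
    (hφ : ContinuousOn (fun p : ℝ × ℝ => φ p.1 p.2) (Icc 0 T ×ˢ Icc (0:ℝ) 1))
    (hφ' : ContinuousOn (fun p : ℝ × ℝ => φ' p.1 p.2) (Icc 0 T ×ˢ Icc (0:ℝ) 1))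
    (hd : ∀ t ∈ Icc 0 T, ∀ ξ ∈ Icc (0:ℝ) 1,
      HasDerivWithinAt (fun s => φ s ξ) (φ' t ξ) (Icc 0 T) t)
    {t : ℝ} (ht : t ∈ Icc 0 T) :
    HasDerivWithinAt (fun t => ∫ ξ in (0:ℝ)..1, w ξ * φ t ξ)
      (∫ ξ in (0:ℝ)..1, w ξ * φ' t ξ) (Icc 0 T) t := by
  obtain ⟨C, hC⟩ := cord_bdd T φ' hφ'
  have hsub : ∀ ξ : ℝ, ξ ∈ Set.uIoc (0:ℝ) 1 → ξ ∈ Icc (0:ℝ) 1 := fun ξ hξ => by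
    rw [uIoc_of_le zero_le_one] at hξ; exact Ioc_subset_Icc_self hξ
  rw [hasDerivWithinAt_iff_tendsto_slope]
  have key : ∀ s ∈ Icc 0 T, slope (fun t => ∫ ξ in (0:ℝ)..1, w ξ * φ t ξ) t s
      = ∫ ξ in (0:ℝ)..1, w ξ * slope (fun s => φ s ξ) t s := by
    intro s hs
    simp only [slope_def_field]
    rw [← intervalIntegral.integral_sub (cord_int T w hw φ hφ hs) (cord_int T w hw φ hφ ht),
      ← intervalIntegral.integral_div]
    congr 1; ext ξ; ring
  have hmem : ∀ᶠ s in 𝓝[Icc 0 T \ {t}] t, s ∈ Icc 0 T \ {t} := self_mem_nhdsWithin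
  refine Tendsto.congr' (f₁ := fun s => ∫ ξ in (0:ℝ)..1, w ξ * slope (fun s => φ s ξ) t s) ?_ ?_
  · filter_upwards [hmem] with s hs using (key s hs.1).symm
  apply intervalIntegral.tendsto_integral_filter_of_dominated_convergence (fun ξ => ‖w ξ‖ * C)
  · filter_upwards [hmem] with s hs
    have h := ((cord_int T w hw φ hφ hs.1).sub (cord_int T w hw φ hφ ht)).div_const (s - t)
    refine (h.congr ?_ : IntervalIntegrable _ volume 0 1).def'.aestronglyMeasurable
    refine fun ξ _ => ?_
    simp only [slope_def_field]; ring
  · filter_upwards [hmem] with s hs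
    refine Eventually.of_forall fun ξ hξ => ?_
    rw [norm_mul]
    refine mul_le_mul_of_nonneg_left ?_ (norm_nonneg _)
    have h := (convex_Icc 0 T).norm_image_sub_le_of_norm_hasDerivWithin_le
      (fun r hr => hd r hr ξ (hsub ξ hξ)) (fun r hr => hC r hr ξ (hsub ξ hξ)) ht hs.1
    rw [slope_def_field, norm_div]
    have : 0 < ‖s - t‖ := norm_pos_iff.2 (sub_ne_zero.2 hs.2)
    exact (div_le_iff₀ this).2 h
  · exact hw.norm.mul_const C
  · refine Eventually.of_forall fun ξ hξ => ?_
    exact (hasDerivWithinAt_iff_tendsto_slope.1 (hd t ht ξ (hsub ξ hξ))).const_mul _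

lemma cord_mem {T ε : ℝ} (hε0 : 0 < ε) (hε1 : ε ≤ 1) {t ξ : ℝ} (ht : t ∈ Icc 0 T)
    (hξ : ξ ∈ Icc (0:ℝ) 1) : 0 ≤ ε * t * ξ ∧ ε * t * ξ ≤ t := by
  obtain ⟨h1, h2⟩ := ht
  obtain ⟨h3, h4⟩ := hξ
  refine ⟨by positivity, ?_⟩
  have a : ε * t ≤ t := by nlinarith
  have b : 0 ≤ ε * t := by positivity
  nlinarith

lemma cord_jcont {T ε : ℝ} (hε0 : 0 < ε) (hε1 : ε ≤ 1) {U : Set (ℝ × ℝ)}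
    (hDU : {p : ℝ × ℝ | 0 ≤ p.2 ∧ p.2 ≤ p.1 ∧ p.1 ≤ T} ⊆ U)
    {K : ℝ × ℝ → ℝ} {y : ℝ → ℝ} (hK : ContinuousOn K U) (hy : ContinuousOn y (Icc 0 T)) :
    ContinuousOn (fun p : ℝ × ℝ => K (p.1, ε * p.1 * p.2) * y (ε * p.1 * p.2))
      (Icc 0 T ×ˢ Icc (0:ℝ) 1) := by
  apply ContinuousOn.mul
  · refine hK.comp (f := fun p : ℝ × ℝ => (p.1, ε * p.1 * p.2)) (by fun_prop) ?_
    rintro ⟨t, ξ⟩ ⟨ht, hξ⟩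
    have := cord_mem hε0 hε1 ht hξ
    exact hDU ⟨this.1, this.2, ht.2⟩
  · refine hy.comp (f := fun p : ℝ × ℝ => ε * p.1 * p.2) (by fun_prop) ?_
    rintro ⟨t, ξ⟩ ⟨ht, hξ⟩
    have := cord_mem hε0 hε1 ht hξ
    exact ⟨this.1, this.2.trans ht.2⟩

lemma cord_main (T ε : ℝ) (hT : 0 < T) (hε0 : 0 < ε) (hε1 : ε ≤ 1) {U : Set (ℝ × ℝ)}
    (hU : IsOpen U) (hDU : {p : ℝ × ℝ | 0 ≤ p.2 ∧ p.2 ≤ p.1 ∧ p.1 ≤ T} ⊆ U) (j : ℕ) :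
    ∀ (w : ℝ → ℝ) (K : ℝ × ℝ → ℝ) (y : ℝ → ℝ), IntervalIntegrable w volume 0 1 →
      ContDiffOn ℝ j K U → ContDiffOn ℝ j y (Icc 0 T) →
      ContDiffOn ℝ j (fun t => ∫ ξ in (0:ℝ)..1,
        w ξ * (K (t, ε * t * ξ) * y (ε * t * ξ))) (Icc 0 T) := by
  have hud : UniqueDiffOn ℝ (Icc 0 T) := uniqueDiffOn_Icc hT
  induction j with
  | zero =>
    intro w K y hw hK hy
    simp only [Nat.cast_zero, contDiffOn_zero] at hK hy ⊢
    exact cord_cont T w hw (fun t ξ => K (t, ε * t * ξ) * y (ε * t * ξ))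
      (cord_jcont hε0 hε1 hDU hK hy)
  | succ n ih =>
    intro w K y hw hK hy
    have hKc := hK.continuousOn
    have hyc := hy.continuousOn
    have hKd : DifferentiableOn ℝ K U := hK.differentiableOn (by simp)
    have hyd : DifferentiableOn ℝ y (Icc 0 T) := hy.differentiableOn (by simp)
    have hK' : ContDiffOn ℝ n (fderiv ℝ K) U := hK.fderiv_of_isOpen hU (by simp)
    have hy' : ContDiffOn ℝ n (derivWithin y (Icc 0 T)) (Icc 0 T) :=
      hy.derivWithin hud (by simp)
    have hK1 : ContDiffOn ℝ n (fun p => fderiv ℝ K p (1, 0)) U := hK'.clm_apply contDiffOn_const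
    have hK2 : ContDiffOn ℝ n (fun p => fderiv ℝ K p (0, 1)) U := hK'.clm_apply contDiffOn_const
    have hKn : ContDiffOn ℝ n K U := hK.of_le (by simp)
    have hyn : ContDiffOn ℝ n y (Icc 0 T) := hy.of_le (by simp)
    have hw2 : IntervalIntegrable (fun ξ => w ξ * (ε * ξ)) volume 0 1 :=
      hw.mul_continuousOn (by fun_prop)
    have c1 := cord_jcont hε0 hε1 hDU hK1.continuousOn hyc
    have c2 := cord_jcont hε0 hε1 hDU hK2.continuousOn hyc
    have c3 := cord_jcont hε0 hε1 hDU hKc hy'.continuousOn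
    have main : ∀ t ∈ Icc 0 T, HasDerivWithinAt (fun t => ∫ ξ in (0:ℝ)..1,
        w ξ * (K (t, ε * t * ξ) * y (ε * t * ξ)))
        ((∫ ξ in (0:ℝ)..1, w ξ * (fderiv ℝ K (t, ε * t * ξ) (1, 0) * y (ε * t * ξ)))
        + (∫ ξ in (0:ℝ)..1, (w ξ * (ε * ξ)) * (fderiv ℝ K (t, ε * t * ξ) (0, 1) * y (ε * t * ξ)))
        + (∫ ξ in (0:ℝ)..1, (w ξ * (ε * ξ)) * (K (t, ε * t * ξ) *
            derivWithin y (Icc 0 T) (ε * t * ξ)))) (Icc 0 T) t := by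
      intro t ht
      have h := cord_deriv T w hw (fun t ξ => K (t, ε * t * ξ) * y (ε * t * ξ))
        (fun t ξ => fderiv ℝ K (t, ε * t * ξ) (1, 0) * y (ε * t * ξ)
          + (ε * ξ) * (fderiv ℝ K (t, ε * t * ξ) (0, 1) * y (ε * t * ξ))
          + (ε * ξ) * (K (t, ε * t * ξ) * derivWithin y (Icc 0 T) (ε * t * ξ)))
        (cord_jcont hε0 hε1 hDU hKc hyc)
        ((c1.add (ContinuousOn.mul (by fun_prop) c2)).add (ContinuousOn.mul (by fun_prop) c3))
        ?_ ht
      · convert h using 1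
        have i1 := cord_int T w hw
          (fun t ξ => fderiv ℝ K (t, ε * t * ξ) (1, 0) * y (ε * t * ξ)) c1 ht
        have i2 := cord_int T _ hw2
          (fun t ξ => fderiv ℝ K (t, ε * t * ξ) (0, 1) * y (ε * t * ξ)) c2 ht
        have i3 := cord_int T _ hw2
          (fun t ξ => K (t, ε * t * ξ) * derivWithin y (Icc 0 T) (ε * t * ξ)) c3 ht
        rw [← intervalIntegral.integral_add i1 i2, ← intervalIntegral.integral_add (i1.add i2) i3]
        congr 1; ext ξ; ring
      · intro t ht ξ hξ
        have hm := cord_mem hε0 hε1 ht hξ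
        have hmU : (t, ε * t * ξ) ∈ U := hDU ⟨hm.1, hm.2, ht.2⟩
        have hlin : HasDerivWithinAt (fun s : ℝ => ε * s * ξ) (ε * ξ) (Icc 0 T) t := by
          have := (((hasDerivAt_id t).const_mul ε).mul_const ξ).hasDerivWithinAt (s := Icc 0 T)
          simpa using this
        have hKF : HasFDerivAt K (fderiv ℝ K (t, ε * t * ξ)) (t, ε * t * ξ) :=
          (hKd.differentiableAt (hU.mem_nhds hmU)).hasFDerivAt
        have hKs := hKF.comp_hasDerivWithinAt (f := fun s : ℝ => (s, ε * s * ξ)) t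
          ((hasDerivWithinAt_id t (Icc 0 T)).prodMk hlin)
        have hyF := (hyd (ε * t * ξ) ⟨hm.1, hm.2.trans ht.2⟩).hasDerivWithinAt
        have hys := hyF.scomp t hlin (fun s hs => by
          have := cord_mem hε0 hε1 hs hξ
          exact ⟨this.1, this.2.trans hs.2⟩)
        have hh := hKs.mul hys
        refine hh.congr_deriv ?_
        have e : ((1 : ℝ), ε * ξ) = (1, 0) + (ε * ξ) • ((0 : ℝ), (1 : ℝ)) := by simp
        rw [e, map_add, map_smul]
        simp only [Function.comp, smul_eq_mul]
        ring
    push_cast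
    rw [contDiffOn_succ_iff_derivWithin hud]
    refine ⟨fun t ht => (main t ht).differentiableWithinAt, by simp, ?_⟩
    refine ContDiffOn.congr (((ih w _ y hw hK1 hyn).add (ih _ _ y hw2 hK2 hyn)).add
      (ih _ K _ hw2 hKn hy')) ?_
    intro t ht
    exact (main t ht).derivWithin (hud t ht)


/-- The delayed cordial operator maps `C^j[0,T]` into `C^j[0,T]`: if `K` is `C^j` on an
open set containing the triangle `D = {(t,s) : 0 ≤ s ≤ t ≤ T}` and `y` is `C^j` on
`[0,T]`, then `G(t) = ∫₀¹ (1−ξ)^{−μ} ξ^{μ+γ−1} K(t, εtξ) y(εtξ) dξ` is `C^j` on `[0,T]`,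
and for `t ∈ (0,T]` it equals `(εt)^{−γ} ∫₀^{εt} (εt−τ)^{−μ} τ^{μ+γ−1} K(t,τ) y(τ) dτ`. -/
theorem cordial_operator_maps_Cj
    (T μ γ ε : ℝ) (j : ℕ) (hT : 0 < T) (hμ0 : 0 ≤ μ) (hμ1 : μ < 1)
    (hγ : 0 < γ) (hμγ : 1 ≤ μ + γ) (hε0 : 0 < ε) (hε1 : ε ≤ 1)
    (K : ℝ → ℝ → ℝ) (y : ℝ → ℝ)
    (hK : ∃ U : Set (ℝ × ℝ), IsOpen U ∧
      {p : ℝ × ℝ | 0 ≤ p.2 ∧ p.2 ≤ p.1 ∧ p.1 ≤ T} ⊆ U ∧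
      ContDiffOn ℝ j (fun p : ℝ × ℝ => K p.1 p.2) U)
    (hy : ContDiffOn ℝ j y (Icc 0 T))
    (G : ℝ → ℝ)
    (hG : ∀ t, G t = ∫ ξ in (0:ℝ)..1,
      (1 - ξ) ^ (-μ) * ξ ^ (μ + γ - 1) * K t (ε * t * ξ) * y (ε * t * ξ)) :
    ContDiffOn ℝ j G (Icc 0 T) ∧
      ∀ t ∈ Ioc (0:ℝ) T, G t = (ε * t) ^ (-γ) *
        ∫ τ in (0:ℝ)..(ε * t), (ε * t - τ) ^ (-μ) * τ ^ (μ + γ - 1) * K t τ * y τ := by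
  constructor
  · obtain ⟨U, hU, hDU, hK⟩ := hK
    have hw : IntervalIntegrable (fun ξ : ℝ => (1 - ξ) ^ (-μ) * ξ ^ (μ + γ - 1)) volume 0 1 := by
      apply IntervalIntegrable.mul_continuousOn
      · have h := (intervalIntegrable_rpow' (a := 0) (b := 1) (r := -μ) (by linarith)).comp_sub_left 1
        simpa using h.symm
      · exact (Real.continuous_rpow_const (by linarith)).continuousOn
    refine (cord_main T ε hT hε0 hε1 hU hDU j _ (fun p => K p.1 p.2) y hw hK hy).congr ?_
    intro t _
    rw [hG]
    congr 1; ext ξ; ring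
  · intro t ht
    have hc : 0 < ε * t := mul_pos hε0 ht.1
    rw [hG]
    set c := ε * t with hcdef
    have h := intervalIntegral.mul_integral_comp_mul_left (a := 0) (b := 1) (c := c)
      (f := fun τ : ℝ => (c - τ) ^ (-μ) * τ ^ (μ + γ - 1) * K t τ * y τ)
    simp only [mul_zero, mul_one] at h
    rw [← h, ← mul_assoc, ← intervalIntegral.integral_const_mul]
    apply intervalIntegral.integral_congr
    intro ξ hξ
    rw [uIcc_of_le zero_le_one] at hξ
    have e1 : (c - c * ξ) ^ (-μ) = c ^ (-μ) * (1 - ξ) ^ (-μ) := by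
      rw [← Real.mul_rpow hc.le (by linarith [hξ.2])]; congr 1; ring
    have e2 : (c * ξ) ^ (μ + γ - 1) = c ^ (μ + γ - 1) * ξ ^ (μ + γ - 1) :=
      Real.mul_rpow hc.le hξ.1
    have e3 : c ^ (-γ) * c * c ^ (-μ) * c ^ (μ + γ - 1) = 1 := by
      nth_rewrite 2 [← Real.rpow_one c]
      rw [← Real.rpow_add hc, ← Real.rpow_add hc, ← Real.rpow_add hc]
      rw [show -γ + 1 + -μ + (μ + γ - 1) = 0 by ring, Real.rpow_zero]
    simp only [e1, e2]
    linear_combination (-((1 - ξ) ^ (-μ) * ξ ^ (μ + γ - 1) * K t (c * ξ) * y (c * ξ))) * e3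
end

section
/- Let 0 ≤ μ < 1, γ > 0 with μ + γ ≥ 1, ε ∈ (0,1], λ ∈ (0,1], N ∈ ℕ, and real coefficients a₀, …, a_N. Define the fractional polynomial φ(θ) = Σ_{k=0}^{N} a_k θ^{kλ} for θ ∈ [0,1]. Then for every θ ∈ (0,1], θ^{−γ} ∫₀^θ (θ−η)^{−μ} η^{μ+γ−1} φ(εη) dη = Σ_{k=0}^{N} a_k ε^{kλ} B(1−μ, μ+γ+kλ) θ^{kλ}. In particular, the weakly singular cordial operator with constant kernel maps the fractional polynomial space P_N^λ = span{1, θ^λ, …, θ^{Nλ}} into itself. -/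
open Set MeasureTheory intervalIntegral

theorem single_term_int (μ p θ : ℝ) (hμ1 : μ < 1) (hp : 0 ≤ p) :
    IntervalIntegrable (fun η : ℝ => (θ - η) ^ (-μ) * η ^ p) volume 0 θ := by
  have h1 : IntervalIntegrable (fun x : ℝ => x ^ (-μ)) volume θ 0 :=
    intervalIntegral.intervalIntegrable_rpow' (by linarith)
  have h2 := h1.comp_sub_left θ
  simp only [sub_self, sub_zero] at h2
  exact h2.mul_continuousOn (Real.continuous_rpow_const hp).continuousOn

theorem single_term_eq (μ p θ : ℝ) (hθ : 0 < θ) :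
    (∫ η in (0:ℝ)..θ, (θ - η) ^ (-μ) * η ^ p)
      = θ ^ (p + 1 - μ) * betaFn (1 - μ) (p + 1) := by
  have h := intervalIntegral.integral_comp_sub_mul (a := 0) (b := 1)
    (fun η : ℝ => (θ - η) ^ (-μ) * η ^ p) hθ.ne' θ
  simp only [mul_one, mul_zero, sub_self, sub_zero, smul_eq_mul] at h
  have h3 : (∫ η in (0:ℝ)..θ, (θ - η) ^ (-μ) * η ^ p) =
      θ * ∫ x in (0:ℝ)..1, (θ - (θ - θ * x)) ^ (-μ) * (θ - θ * x) ^ p := by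
    rw [h, mul_inv_cancel_left₀ hθ.ne']
  rw [h3, betaFn, ← intervalIntegral.integral_const_mul, ← intervalIntegral.integral_const_mul]
  apply intervalIntegral.integral_congr
  intro x hx
  rw [uIcc_of_le zero_le_one] at hx
  have e1 : θ - (θ - θ * x) = θ * x := by ring
  have e2 : θ - θ * x = θ * (1 - x) := by ring
  have e3 : p + 1 - μ = 1 + (-μ) + p := by ring
  have e4 : 1 - μ - 1 = -μ := by ring
  simp only [e1]
  rw [e2, Real.mul_rpow hθ.le hx.1, Real.mul_rpow hθ.le (by linarith [hx.2]), e3, e4,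
    Real.rpow_add hθ, Real.rpow_add hθ, Real.rpow_one, add_sub_cancel_right]
  ring

/-- The weakly singular cordial operator with constant kernel maps the fractional
polynomial space `P_N^λ = span{1, θ^λ, …, θ^{Nλ}}` into itself: for the fractional
polynomial `φ(θ) = Σ_{k=0}^{N} a_k θ^{kλ}` and every `θ ∈ (0,1]`,
`θ^{−γ} ∫₀^θ (θ−η)^{−μ} η^{μ+γ−1} φ(εη) dη = Σ_{k=0}^{N} a_k ε^{kλ} B(1−μ, μ+γ+kλ) θ^{kλ}`. -/
theorem cordial_operator_fractional_polynomial
    (μ γ ε lam : ℝ) (N : ℕ) (a : ℕ → ℝ)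
    (hμ0 : 0 ≤ μ) (hμ1 : μ < 1) (hγ : 0 < γ) (hμγ : 1 ≤ μ + γ)
    (hε0 : 0 < ε) (hε1 : ε ≤ 1) (hlam0 : 0 < lam) (hlam1 : lam ≤ 1)
    (φ : ℝ → ℝ)
    (hφ : ∀ θ ∈ Icc (0:ℝ) 1, φ θ = ∑ k ∈ Finset.range (N + 1), a k * θ ^ ((k : ℝ) * lam)) :
    ∀ θ ∈ Ioc (0:ℝ) 1,
      θ ^ (-γ) * (∫ η in (0:ℝ)..θ, (θ - η) ^ (-μ) * η ^ (μ + γ - 1) * φ (ε * η))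
        = ∑ k ∈ Finset.range (N + 1),
            a k * ε ^ ((k : ℝ) * lam) * betaFn (1 - μ) (μ + γ + (k : ℝ) * lam)
              * θ ^ ((k : ℝ) * lam) := by
  intro θ hθ
  obtain ⟨h0, h1⟩ := hθ
  have hp : ∀ k : ℕ, 0 ≤ μ + γ - 1 + (k : ℝ) * lam := fun k => by
    have : 0 ≤ (k : ℝ) * lam := by positivity
    linarith
  have hc : (∫ η in (0:ℝ)..θ, (θ - η) ^ (-μ) * η ^ (μ + γ - 1) * φ (ε * η)) =
      ∫ η in (0:ℝ)..θ, ∑ k ∈ Finset.range (N + 1), (a k * ε ^ ((k : ℝ) * lam)) *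
        ((θ - η) ^ (-μ) * η ^ (μ + γ - 1 + (k : ℝ) * lam)) := by
    apply intervalIntegral.integral_congr_ae
    refine Filter.Eventually.of_forall fun η hη => ?_
    rw [uIoc_of_le h0.le] at hη
    have hη0 := hη.1
    have hη1 : η ≤ 1 := hη.2.trans h1
    rw [hφ (ε * η) ⟨by positivity, mul_le_one₀ hε1 hη0.le hη1⟩, Finset.mul_sum]
    refine Finset.sum_congr rfl fun k _ => ?_
    rw [Real.mul_rpow hε0.le hη0.le, Real.rpow_add hη0]
    ring
  rw [hc, intervalIntegral.integral_finset_sum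
    (fun k _ => (single_term_int μ _ θ hμ1 (hp k)).const_mul _), Finset.mul_sum]
  refine Finset.sum_congr rfl fun k _ => ?_
  rw [intervalIntegral.integral_const_mul, single_term_eq μ _ θ h0]
  have e1 : μ + γ - 1 + (k : ℝ) * lam + 1 = μ + γ + (k : ℝ) * lam := by ring
  have e2 : θ ^ ((k : ℝ) * lam) = θ ^ (-γ) * θ ^ (μ + γ + (k : ℝ) * lam - μ) := by
    rw [← Real.rpow_add h0]; congr 1; ring
  rw [e1, e2]
  ring
end

section
/- Let 0 ≤ μ < 1, γ > 0 with μ + γ ≥ 1 and ε ∈ (0,1]. Let p̃₁, q̃₁ be continuous on [0,1] and K̄₁, K̄₂ continuous on the triangle {(θ,η) : 0 ≤ η ≤ θ ≤ 1}. Let e*, E₁, …, E₉ be bounded continuous functions on [0,1], define e(θ) = ∫₀^θ e*(η) dη + E₈(θ) + E₉(θ), and suppose that for all θ ∈ (0,1]: e*(θ) = p̃₁(θ) ∫₀^θ e*(η) dη + ε q̃₁(θ) ∫₀^θ e*(εη) dη + θ^{−γ} ∫₀^θ (θ−η)^{−μ} η^{μ+γ−1} K̄₁(θ,η) e(η) dη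 + θ^{−γ} ∫₀^θ (θ−η)^{−μ} η^{μ+γ−1} K̄₂(θ,εη) e(εη) dη + Σ_{p=1}^{7} E_p(θ). Then there exists a constant C > 0, depending only on μ, γ, ε, p̃₁, q̃₁, K̄₁, K̄₂ and not on e*, e, E₁, …, E₉, such that sup_{[0,1]} |e*| ≤ C Σ_{p=1}^{9} sup_{[0,1]} |E_p| and sup_{[0,1]} |e| ≤ C ( sup_{[0,1]} |e*| + sup_{[0,1]} |E₈| + sup_{[0,1]} |E₉| ). -/
open Set MeasureTheory intervalIntegral

lemma ep_le_sup (f : ℝ → ℝ) (hf : ContinuousOn f (Icc 0 1)) (x : ℝ) (hx : x ∈ Icc (0:ℝ) 1) :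
    |f x| ≤ ⨆ θ ∈ Icc (0:ℝ) 1, |f θ| := by
  obtain ⟨D, hD⟩ := isCompact_Icc.exists_bound_of_continuousOn hf
  have hD0 : 0 ≤ D := (norm_nonneg _).trans (hD x hx)
  have hb : BddAbove (range fun θ : ℝ => ⨆ (_ : θ ∈ Icc (0:ℝ) 1), |f θ|) := by
    refine ⟨D, ?_⟩
    rintro _ ⟨y, rfl⟩
    exact Real.iSup_le (fun hy => hD y hy) hD0
  refine le_trans ?_ (le_ciSup hb x)
  simp [hx]

lemma ep_sup_le (f : ℝ → ℝ) (D : ℝ) (hD0 : 0 ≤ D) (h : ∀ x ∈ Icc (0:ℝ) 1, |f x| ≤ D) :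
    (⨆ θ ∈ Icc (0:ℝ) 1, |f θ|) ≤ D :=
  Real.iSup_le (fun x => Real.iSup_le (fun hx => h x hx) hD0) hD0

lemma ep_sup_nonneg (f : ℝ → ℝ) : 0 ≤ ⨆ θ ∈ Icc (0:ℝ) 1, |f θ| :=
  Real.iSup_nonneg (fun _ => Real.iSup_nonneg (fun _ => abs_nonneg _))

lemma ep_kernel (μ γ θ M R : ℝ) (hμ1 : μ < 1) (hμγ : 1 ≤ μ + γ)
    (hθ : 0 < θ) (k g : ℝ → ℝ) (hM : 0 ≤ M)
    (hk : ∀ η ∈ Ioc 0 θ, |k η| ≤ M) (hg : ∀ η ∈ Ioc 0 θ, |g η| ≤ R) :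
    |θ ^ (-γ) * (∫ η in (0:ℝ)..θ, (θ - η) ^ (-μ) * η ^ (μ + γ - 1) * k η * g η)|
      ≤ M * R / (1 - μ) := by
  have hR : 0 ≤ R := (abs_nonneg _).trans (hg θ ⟨hθ, le_rfl⟩)
  have hint : IntervalIntegrable (fun η : ℝ => (θ - η) ^ (-μ)) volume 0 θ := by
    have h := (intervalIntegral.intervalIntegrable_rpow' (a := 0) (b := θ) (r := -μ)
      (by linarith)).comp_sub_left θ
    simpa using h.symm
  have h1 : ‖∫ η in (0:ℝ)..θ, (θ - η) ^ (-μ) * η ^ (μ + γ - 1) * k η * g η‖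
      ≤ ∫ η in (0:ℝ)..θ, (θ - η) ^ (-μ) * (θ ^ (μ + γ - 1) * M * R) := by
    refine intervalIntegral.norm_integral_le_of_norm_le hθ.le ?_ (hint.mul_const _)
    refine Filter.Eventually.of_forall fun η hη => ?_
    have a1 : 0 ≤ (θ - η) ^ (-μ) := Real.rpow_nonneg (by linarith [hη.2]) _
    have a2 : 0 ≤ η ^ (μ + γ - 1) := Real.rpow_nonneg hη.1.le _
    have a3 : η ^ (μ + γ - 1) ≤ θ ^ (μ + γ - 1) :=
      Real.rpow_le_rpow hη.1.le hη.2 (by linarith)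
    rw [Real.norm_eq_abs, abs_mul, abs_mul, abs_mul, abs_of_nonneg a1, abs_of_nonneg a2,
      mul_assoc, mul_assoc, mul_assoc]
    have := hk η hη
    have := hg η hη
    gcongr
  have h2 : (∫ η in (0:ℝ)..θ, (θ - η) ^ (-μ)) = θ ^ (1 - μ) / (1 - μ) := by
    rw [intervalIntegral.integral_comp_sub_left (fun x : ℝ => x ^ (-μ)) θ]
    rw [sub_self, sub_zero, integral_rpow (Or.inl (by linarith))]
    rw [Real.zero_rpow (by linarith)]
    rw [show -μ + 1 = 1 - μ by ring, sub_zero]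
  rw [intervalIntegral.integral_mul_const, h2] at h1
  have h0 : 0 ≤ θ ^ (-γ) := Real.rpow_nonneg hθ.le _
  rw [abs_mul, abs_of_nonneg h0]
  refine (mul_le_mul_of_nonneg_left h1 h0).trans (le_of_eq ?_)
  have h3 : θ ^ (-γ) * θ ^ (1 - μ) * θ ^ (μ + γ - 1) = 1 := by
    rw [← Real.rpow_add hθ, ← Real.rpow_add hθ]
    rw [show -γ + (1 - μ) + (μ + γ - 1) = 0 by ring, Real.rpow_zero]
  calc _ = (θ ^ (-γ) * θ ^ (1 - μ) * θ ^ (μ + γ - 1)) * (M * R / (1 - μ)) := by ring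
    _ = _ := by rw [h3, one_mul]

lemma ep_gronwall (u : ℝ → ℝ) (hu : Continuous u) (A B : ℝ) (hA : 0 < A)
    (h : ∀ θ ∈ Ioc (0:ℝ) 1, |u θ| ≤ A * (∫ η in (0:ℝ)..θ, |u η|) + B) :
    ∀ θ ∈ Icc (0:ℝ) 1, |u θ| ≤ B * Real.exp A := by
  have hd : ∀ x, HasDerivAt (fun θ => ∫ η in (0:ℝ)..θ, |u η|) |u x| x := fun x =>
    (hu.abs.integral_hasStrictDerivAt 0 x).hasDerivAt
  have hv : Continuous (fun θ => ∫ η in (0:ℝ)..θ, |u η|) :=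
    continuous_iff_continuousAt.2 fun x => (hd x).continuousAt
  have h' : ∀ θ ∈ Icc (0:ℝ) 1, |u θ| ≤ A * (∫ η in (0:ℝ)..θ, |u η|) + B := by
    have hc : IsClosed {θ | |u θ| ≤ A * (∫ η in (0:ℝ)..θ, |u η|) + B} :=
      isClosed_le hu.abs ((continuous_const.mul hv).add continuous_const)
    have := closure_minimal (s := Ioc (0:ℝ) 1) h hc
    rw [closure_Ioc (by norm_num)] at this
    exact this
  have hB : 0 ≤ B := by
    have := h' 0 (by simp)
    simp only [intervalIntegral.integral_same, mul_zero, zero_add] at this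
    exact (abs_nonneg _).trans this
  intro θ hθ
  have hg := norm_le_gronwallBound_of_norm_deriv_right_le
    (f := fun θ => ∫ η in (0:ℝ)..θ, |u η|) (f' := fun x => |u x|) (δ := 0) (K := A) (ε := B)
    (a := 0) (b := 1) hv.continuousOn (fun x _ => (hd x).hasDerivWithinAt) (by simp)
    (fun x hx => by
      rw [Real.norm_eq_abs, abs_abs]
      refine (h' x ⟨hx.1, hx.2.le⟩).trans ?_
      have := le_abs_self (∫ η in (0:ℝ)..x, |u η|)
      rw [Real.norm_eq_abs]
      gcongr) θ hθ
  rw [gronwallBound_of_K_ne_0 hA.ne'] at hg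
  have h3 := (le_abs_self _).trans hg
  have h4 : Real.exp (A * (θ - 0)) ≤ Real.exp A := by
    apply Real.exp_le_exp.2
    nlinarith [hθ.2]
  have h5 : A * (∫ η in (0:ℝ)..θ, |u η|) ≤ B * (Real.exp (A * (θ - 0)) - 1) := by
    refine (mul_le_mul_of_nonneg_left h3 hA.le).trans (le_of_eq ?_)
    field_simp
    ring
  have h6 := mul_le_mul_of_nonneg_left h4 hB
  linarith [h' θ hθ]

/-- Abstract error-propagation theorem (supremum-norm form) of the convergence
analysis: if the errors `e*`, `e` satisfy the displayed identity with consistency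
error terms `E₁, …, E₉`, then `sup |e*| ≤ C Σ_{p=1}^{9} sup |E_p|` and
`sup |e| ≤ C (sup |e*| + sup |E₈| + sup |E₉|)`, with `C` independent of
`e*, e, E₁, …, E₉`. -/
theorem error_propagation_sup_norm
    (μ γ ε : ℝ) (hμ0 : 0 ≤ μ) (hμ1 : μ < 1) (hγ : 0 < γ) (hμγ : 1 ≤ μ + γ)
    (hε0 : 0 < ε) (hε1 : ε ≤ 1)
    (p₁ q₁ : ℝ → ℝ) (K₁ K₂ : ℝ → ℝ → ℝ)
    (hp : ContinuousOn p₁ (Icc 0 1)) (hq : ContinuousOn q₁ (Icc 0 1))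
    (hK₁ : ContinuousOn (fun p : ℝ × ℝ => K₁ p.1 p.2)
      {p : ℝ × ℝ | 0 ≤ p.2 ∧ p.2 ≤ p.1 ∧ p.1 ≤ 1})
    (hK₂ : ContinuousOn (fun p : ℝ × ℝ => K₂ p.1 p.2)
      {p : ℝ × ℝ | 0 ≤ p.2 ∧ p.2 ≤ p.1 ∧ p.1 ≤ 1}) :
    ∃ C > 0, ∀ estar e E1 E2 E3 E4 E5 E6 E7 E8 E9 : ℝ → ℝ,
      ContinuousOn estar (Icc 0 1) →
      ContinuousOn E1 (Icc 0 1) → ContinuousOn E2 (Icc 0 1) →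
      ContinuousOn E3 (Icc 0 1) → ContinuousOn E4 (Icc 0 1) →
      ContinuousOn E5 (Icc 0 1) → ContinuousOn E6 (Icc 0 1) →
      ContinuousOn E7 (Icc 0 1) → ContinuousOn E8 (Icc 0 1) →
      ContinuousOn E9 (Icc 0 1) →
      (∀ θ, e θ = (∫ η in (0:ℝ)..θ, estar η) + E8 θ + E9 θ) →
      (∀ θ ∈ Ioc (0:ℝ) 1, estar θ =
        p₁ θ * (∫ η in (0:ℝ)..θ, estar η)
        + ε * q₁ θ * (∫ η in (0:ℝ)..θ, estar (ε * η))
        + θ ^ (-γ) * (∫ η in (0:ℝ)..θ,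
            (θ - η) ^ (-μ) * η ^ (μ + γ - 1) * K₁ θ η * e η)
        + θ ^ (-γ) * (∫ η in (0:ℝ)..θ,
            (θ - η) ^ (-μ) * η ^ (μ + γ - 1) * K₂ θ (ε * η) * e (ε * η))
        + (E1 θ + E2 θ + E3 θ + E4 θ + E5 θ + E6 θ + E7 θ)) →
      (⨆ θ ∈ Icc (0:ℝ) 1, |estar θ|) ≤ C *
          ((⨆ θ ∈ Icc (0:ℝ) 1, |E1 θ|) + (⨆ θ ∈ Icc (0:ℝ) 1, |E2 θ|)
            + (⨆ θ ∈ Icc (0:ℝ) 1, |E3 θ|) + (⨆ θ ∈ Icc (0:ℝ) 1, |E4 θ|)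
            + (⨆ θ ∈ Icc (0:ℝ) 1, |E5 θ|) + (⨆ θ ∈ Icc (0:ℝ) 1, |E6 θ|)
            + (⨆ θ ∈ Icc (0:ℝ) 1, |E7 θ|) + (⨆ θ ∈ Icc (0:ℝ) 1, |E8 θ|)
            + (⨆ θ ∈ Icc (0:ℝ) 1, |E9 θ|))
      ∧ (⨆ θ ∈ Icc (0:ℝ) 1, |e θ|) ≤ C *
          ((⨆ θ ∈ Icc (0:ℝ) 1, |estar θ|) + (⨆ θ ∈ Icc (0:ℝ) 1, |E8 θ|)
            + (⨆ θ ∈ Icc (0:ℝ) 1, |E9 θ|)) := by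
  obtain ⟨M1, hM1⟩ := isCompact_Icc.exists_bound_of_continuousOn hp
  obtain ⟨M2, hM2⟩ := isCompact_Icc.exists_bound_of_continuousOn hq
  have hT : IsCompact {p : ℝ × ℝ | 0 ≤ p.2 ∧ p.2 ≤ p.1 ∧ p.1 ≤ 1} := by
    refine (isCompact_Icc (a := ((0:ℝ), (0:ℝ))) (b := ((1:ℝ), (1:ℝ)))).of_isClosed_subset ?_ ?_
    · exact (isClosed_le continuous_const continuous_snd).inter
        ((isClosed_le continuous_snd continuous_fst).inter
          (isClosed_le continuous_fst continuous_const))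
    · rintro ⟨a, b⟩ ⟨h1, h2, h3⟩
      simp only at h1 h2 h3
      exact ⟨⟨h1.trans h2, h1⟩, ⟨h3, h2.trans h3⟩⟩
  obtain ⟨M3, hM3⟩ := hT.exists_bound_of_continuousOn hK₁
  obtain ⟨M4, hM4⟩ := hT.exists_bound_of_continuousOn hK₂
  obtain ⟨M, hMone, hp', hq', hk1, hk2⟩ : ∃ M : ℝ, 1 ≤ M ∧ (∀ x ∈ Icc (0:ℝ) 1, |p₁ x| ≤ M) ∧
      (∀ x ∈ Icc (0:ℝ) 1, |q₁ x| ≤ M) ∧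
      (∀ x y, 0 ≤ y → y ≤ x → x ≤ 1 → |K₁ x y| ≤ M) ∧
      (∀ x y, 0 ≤ y → y ≤ x → x ≤ 1 → |K₂ x y| ≤ M) := by
    have b1 := le_abs_self M1
    have b2 := le_abs_self M2
    have b3 := le_abs_self M3
    have b4 := le_abs_self M4
    have c1 := abs_nonneg M1
    have c2 := abs_nonneg M2
    have c3 := abs_nonneg M3
    have c4 := abs_nonneg M4
    refine ⟨1 + |M1| + |M2| + |M3| + |M4|, by linarith, fun x hx => ?_, fun x hx => ?_,
      fun x y h1 h2 h3 => ?_, fun x y h1 h2 h3 => ?_⟩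
    · have := hM1 x hx
      rw [Real.norm_eq_abs] at this
      linarith
    · have := hM2 x hx
      rw [Real.norm_eq_abs] at this
      linarith
    · have : |K₁ x y| ≤ M3 := hM3 (x, y) ⟨h1, h2, h3⟩
      linarith
    · have : |K₂ x y| ≤ M4 := hM4 (x, y) ⟨h1, h2, h3⟩
      linarith
  have hm : 0 < 1 - μ := by linarith
  have hMm : 0 ≤ M / (1 - μ) := by positivity
  obtain ⟨A, hAdef⟩ : ∃ A, A = 2 * M + 2 * (M / (1 - μ)) := ⟨_, rfl⟩
  have hA : 1 ≤ A := by linarith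
  have hexp : 1 ≤ Real.exp A := Real.one_le_exp (by linarith)
  have hC : 1 ≤ A * Real.exp A := by nlinarith
  refine ⟨A * Real.exp A, by linarith, ?_⟩
  intro estar e E1 E2 E3 E4 E5 E6 E7 E8 E9 hes h1 h2 h3 h4 h5 h6 h7 h8 h9 he hid
  have s1 := ep_le_sup E1 h1
  have s2 := ep_le_sup E2 h2
  have s3 := ep_le_sup E3 h3
  have s4 := ep_le_sup E4 h4
  have s5 := ep_le_sup E5 h5
  have s6 := ep_le_sup E6 h6
  have s7 := ep_le_sup E7 h7
  have s8 := ep_le_sup E8 h8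
  have s9 := ep_le_sup E9 h9
  have n1 := ep_sup_nonneg E1
  have n2 := ep_sup_nonneg E2
  have n3 := ep_sup_nonneg E3
  have n4 := ep_sup_nonneg E4
  have n5 := ep_sup_nonneg E5
  have n6 := ep_sup_nonneg E6
  have n7 := ep_sup_nonneg E7
  have n8 := ep_sup_nonneg E8
  have n9 := ep_sup_nonneg E9
  have ss := ep_le_sup estar hes
  have ns := ep_sup_nonneg estar
  generalize (⨆ θ ∈ Icc (0:ℝ) 1, |E1 θ|) = S1 at *
  generalize (⨆ θ ∈ Icc (0:ℝ) 1, |E2 θ|) = S2 at *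
  generalize (⨆ θ ∈ Icc (0:ℝ) 1, |E3 θ|) = S3 at *
  generalize (⨆ θ ∈ Icc (0:ℝ) 1, |E4 θ|) = S4 at *
  generalize (⨆ θ ∈ Icc (0:ℝ) 1, |E5 θ|) = S5 at *
  generalize (⨆ θ ∈ Icc (0:ℝ) 1, |E6 θ|) = S6 at *
  generalize (⨆ θ ∈ Icc (0:ℝ) 1, |E7 θ|) = S7 at *
  generalize (⨆ θ ∈ Icc (0:ℝ) 1, |E8 θ|) = S8 at *
  generalize (⨆ θ ∈ Icc (0:ℝ) 1, |E9 θ|) = S9 at *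
  constructor
  · obtain ⟨u, hu, hue⟩ : ∃ u : ℝ → ℝ, Continuous u ∧ ∀ x ∈ Icc (0:ℝ) 1, u x = estar x :=
      ⟨IccExtend zero_le_one ((Icc (0:ℝ) 1).restrict estar),
        (continuousOn_iff_continuous_restrict.1 hes).Icc_extend',
        fun x hx => by rw [IccExtend_of_mem _ _ hx]; rfl⟩
    have hI : ∀ θ ∈ Icc (0:ℝ) 1, (∫ η in (0:ℝ)..θ, estar η) = ∫ η in (0:ℝ)..θ, u η := by
      intro θ hθ
      refine intervalIntegral.integral_congr fun x hx => ?_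
      rw [uIcc_of_le hθ.1] at hx
      exact (hue x ⟨hx.1, hx.2.trans hθ.2⟩).symm
    have hV : ∀ x θ : ℝ, 0 ≤ x → x ≤ θ → θ ≤ 1 →
        |∫ η in (0:ℝ)..x, estar η| ≤ ∫ η in (0:ℝ)..θ, |u η| := by
      intro x θ hx hxθ hθ
      rw [hI x ⟨hx, hxθ.trans hθ⟩]
      refine (intervalIntegral.abs_integral_le_integral_abs hx).trans ?_
      exact intervalIntegral.integral_mono_interval le_rfl hx hxθ
        (Filter.Eventually.of_forall fun _ => abs_nonneg _) (hu.abs.intervalIntegrable _ _)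
    have key : ∀ θ ∈ Ioc (0:ℝ) 1, |u θ| ≤ A * (∫ η in (0:ℝ)..θ, |u η|) +
        (2 * (M / (1 - μ)) * (S8 + S9) + (S1 + S2 + S3 + S4 + S5 + S6 + S7)) := by
      intro θ hθ
      have hθ' : θ ∈ Icc (0:ℝ) 1 := ⟨hθ.1.le, hθ.2⟩
      have hV' := fun x hx hxθ => hV x θ hx hxθ hθ.2
      generalize (∫ η in (0:ℝ)..θ, |u η|) = V at *
      have hR : ∀ x, 0 ≤ x → x ≤ θ → |e x| ≤ V + S8 + S9 := by
        intro x hx hxθ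
        rw [he x]
        have hx1 : x ∈ Icc (0:ℝ) 1 := ⟨hx, hxθ.trans hθ.2⟩
        have := abs_add_three (∫ η in (0:ℝ)..x, estar η) (E8 x) (E9 x)
        linarith [hV' x hx hxθ, s8 x hx1, s9 x hx1]
      have hεx : ∀ x, 0 ≤ x → ε * x ≤ x := fun x hx => by nlinarith
      have hεx0 : ∀ x, 0 ≤ x → 0 ≤ ε * x := fun x hx => by positivity
      have t1 : |p₁ θ * (∫ η in (0:ℝ)..θ, estar η)| ≤ M * V := by
        rw [abs_mul]
        exact mul_le_mul (hp' θ hθ') (hV' θ hθ.1.le le_rfl) (abs_nonneg _) (by linarith)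
      have t2 : |ε * q₁ θ * (∫ η in (0:ℝ)..θ, estar (ε * η))| ≤ M * V := by
        have : ε * q₁ θ * (∫ η in (0:ℝ)..θ, estar (ε * η))
            = q₁ θ * ∫ η in (0:ℝ)..(ε * θ), estar η := by
          rw [intervalIntegral.integral_comp_mul_left _ hε0.ne', mul_zero, smul_eq_mul]
          field_simp
        rw [this, abs_mul]
        exact mul_le_mul (hq' θ hθ') (hV' _ (hεx0 _ hθ.1.le) (hεx _ hθ.1.le)) (abs_nonneg _)
          (by linarith)
      have t3 := ep_kernel μ γ θ M (V + S8 + S9) hμ1 hμγ hθ.1 (fun η => K₁ θ η) e (by linarith)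
        (fun η hη => hk1 θ η hη.1.le hη.2 hθ.2) (fun η hη => hR η hη.1.le hη.2)
      have t4 := ep_kernel μ γ θ M (V + S8 + S9) hμ1 hμγ hθ.1 (fun η => K₂ θ (ε * η))
        (fun η => e (ε * η)) (by linarith)
        (fun η hη => hk2 θ _ (hεx0 _ hη.1.le) ((hεx _ hη.1.le).trans hη.2) hθ.2)
        (fun η hη => hR _ (hεx0 _ hη.1.le) ((hεx _ hη.1.le).trans hη.2))
      rw [hue θ hθ', hid θ hθ]
      have hr : M * (V + S8 + S9) / (1 - μ) = M / (1 - μ) * V + M / (1 - μ) * (S8 + S9) := by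
        ring
      rw [hr] at t3 t4
      have hrA : A * V = 2 * (M * V) + 2 * (M / (1 - μ) * V) := by rw [hAdef]; ring
      have hrB : 2 * (M / (1 - μ)) * (S8 + S9) = 2 * (M / (1 - μ) * (S8 + S9)) := by ring
      rw [hrA, hrB]
      have r1 := abs_le.1 (s1 θ hθ')
      have r2 := abs_le.1 (s2 θ hθ')
      have r3 := abs_le.1 (s3 θ hθ')
      have r4 := abs_le.1 (s4 θ hθ')
      have r5 := abs_le.1 (s5 θ hθ')
      have r6 := abs_le.1 (s6 θ hθ')
      have r7 := abs_le.1 (s7 θ hθ')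
      have t1 := abs_le.1 t1
      have t2 := abs_le.1 t2
      have t3 := abs_le.1 t3
      have t4 := abs_le.1 t4
      rw [abs_le]
      constructor <;> linarith [r1.1, r1.2, r2.1, r2.2, r3.1, r3.2, r4.1, r4.2, r5.1, r5.2,
        r6.1, r6.2, r7.1, r7.2, t1.1, t1.2, t2.1, t2.2, t3.1, t3.2, t4.1, t4.2]
    have hfin := ep_gronwall u hu A _ (by linarith) key
    have hB : (2 * (M / (1 - μ)) * (S8 + S9) + (S1 + S2 + S3 + S4 + S5 + S6 + S7))
        ≤ A * (S1 + S2 + S3 + S4 + S5 + S6 + S7 + S8 + S9) := by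
      have x1 : 2 * (M / (1 - μ)) * (S8 + S9) ≤ A * (S8 + S9) :=
        mul_le_mul_of_nonneg_right (by linarith) (by linarith)
      have x2 : 1 * (S1 + S2 + S3 + S4 + S5 + S6 + S7)
          ≤ A * (S1 + S2 + S3 + S4 + S5 + S6 + S7) :=
        mul_le_mul_of_nonneg_right hA (by linarith)
      linarith
    refine ep_sup_le _ _ (mul_nonneg (by linarith) (by linarith)) fun x hx => ?_
    have := hfin x hx
    rw [hue x hx] at this
    have y := mul_le_mul_of_nonneg_right hB (Real.exp_pos A).le
    linarith
  · generalize (⨆ θ ∈ Icc (0:ℝ) 1, |estar θ|) = S at *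
    have hle : S + S8 + S9 ≤ A * Real.exp A * (S + S8 + S9) :=
      le_mul_of_one_le_left (by linarith) hC
    refine ep_sup_le _ _ (by linarith) fun x hx => ?_
    rw [he x]
    have hi : ‖∫ η in (0:ℝ)..x, estar η‖ ≤ S * |x - 0| :=
      intervalIntegral.norm_integral_le_of_norm_le_const fun y hy => by
        rw [uIoc_of_le hx.1] at hy
        exact ss y ⟨hy.1.le, hy.2.trans hx.2⟩
    rw [Real.norm_eq_abs, sub_zero, abs_of_nonneg hx.1] at hi
    have hi2 : S * x ≤ S := mul_le_of_le_one_right ns hx.2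
    have := abs_add_three (∫ η in (0:ℝ)..x, estar η) (E8 x) (E9 x)
    linarith [s8 x hx, s9 x hx]
end

section
/- Let 0 ≤ μ < 1, γ > 0 with μ + γ ≥ 1, ε ∈ (0,1], and let α, β be real with −1 < α ≤ −1/2 and −1 < β ≤ −1/2; set w(θ) = (1−θ)^α θ^β. Let p̃₁, q̃₁ be continuous on [0,1] and K̄₁, K̄₂ continuous on the triangle {(θ,η) : 0 ≤ η ≤ θ ≤ 1}. Let e*, E₁, …, E₉ be bounded continuous functions on [0,1], define e(θ) = ∫₀^θ e*(η) dη + E₈(θ) + E₉(θ), and suppose that for all θ ∈ (0,1]: e*(θ) = p̃₁(θ) ∫₀^θ e*(η) dη + ε q̃₁(θ) ∫₀^θ e*(εη) dη + θ^{−γ} ∫₀^θ (θ−η)^{−μ} η^{μ+γ−1} K̄₁(θ,η) e(η) dη + θ^{−γ} ∫₀^θ (θ−η)^{−μ} η^{μ+γ−1} K̄₂(θ,εη) e(εη) dη + Σ_{p=1}^{7} E_p(θ). Then there exists a constant C > 0, independent of e*, e, E₁, …, E₉, such that ‖e*‖_{L²_w} ≤ C ( Σ_{p=1}^{9} ‖E_p‖_{L²_w}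 + sup_{[0,1]} |E₈| + sup_{[0,1]} |E₉| ) and ‖e‖_{L²_w} ≤ C ( ‖e*‖_{L²_w} + ‖E₈‖_{L²_w} + ‖E₉‖_{L²_w} ), where ‖g‖_{L²_w} = (∫₀^1 g(θ)² w(θ) dθ)^{1/2}. -/
open Set MeasureTheory intervalIntegral

/-- The weighted `L²` norm on `(0,1)` with Jacobi weight `w(θ) = (1−θ)^α θ^β`:
`‖g‖_{L²_w} = (∫₀¹ g(θ)² (1−θ)^α θ^β dθ)^{1/2}`. -/
noncomputable def jacobiL2Norm (α β : ℝ) (g : ℝ → ℝ) : ℝ :=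
  Real.sqrt (∫ θ in Set.Ioo (0:ℝ) 1, g θ ^ 2 * ((1 - θ) ^ α * θ ^ β))

lemma jw_one_le {α β : ℝ} (hα : α ≤ 0) (hβ : β ≤ 0) {θ : ℝ} (h : θ ∈ Ioo (0:ℝ) 1) :
    1 ≤ (1 - θ) ^ α * θ ^ β := by
  have h1 : 1 ≤ (1 - θ) ^ α :=
    Real.one_le_rpow_of_pos_of_le_one_of_nonpos (by linarith [h.2]) (by linarith [h.1]) hα
  have h2 : 1 ≤ θ ^ β := Real.one_le_rpow_of_pos_of_le_one_of_nonpos h.1 h.2.le hβ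
  nlinarith

lemma half_rpow_le {a x : ℝ} (ha : -1 < a) (ha0 : a ≤ 0) (hx : 1/2 ≤ x) : x ^ a ≤ 2 := by
  have h1 : x ^ a ≤ (1/2 : ℝ) ^ a := Real.rpow_le_rpow_of_nonpos (by norm_num) hx ha0
  have h2 : (1/2 : ℝ) ^ a ≤ (1/2 : ℝ) ^ (-1:ℝ) :=
    Real.rpow_le_rpow_of_exponent_ge (by norm_num) (by norm_num) ha.le
  have h3 : (1/2 : ℝ) ^ (-1:ℝ) = 2 := by rw [Real.rpow_neg_one]; norm_num
  linarith

lemma sub_rpow_intervalIntegrable {a t : ℝ} (ha : -1 < a) :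
    IntervalIntegrable (fun x : ℝ => (t - x) ^ a) volume 0 t := by
  have h := (intervalIntegral.intervalIntegrable_rpow' (a := 0) (b := t) ha).comp_sub_left t
  simpa using h.symm

lemma jw_integrable {α β : ℝ} (hα0 : -1 < α) (hα : α ≤ 0) (hβ0 : -1 < β) (hβ : β ≤ 0) :
    IntegrableOn (fun θ : ℝ => (1 - θ) ^ α * θ ^ β) (Ioo 0 1) := by
  have i1 : IntegrableOn (fun θ : ℝ => θ ^ β) (Ioo 0 1) :=
    ((intervalIntegrable_iff_integrableOn_Ioo_of_le zero_le_one).1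
      (intervalIntegral.intervalIntegrable_rpow' hβ0))
  have i2 : IntegrableOn (fun θ : ℝ => (1 - θ) ^ α) (Ioo 0 1) :=
    ((intervalIntegrable_iff_integrableOn_Ioo_of_le zero_le_one).1
      (sub_rpow_intervalIntegrable hα0))
  refine Integrable.mono' ((i1.const_mul 2).add (i2.const_mul 2)) ?_ ?_
  · exact (by fun_prop : Measurable (fun θ : ℝ => (1 - θ) ^ α * θ ^ β)).aestronglyMeasurable
  · refine (ae_restrict_iff' measurableSet_Ioo).2 (Filter.Eventually.of_forall ?_)
    intro θ h
    have n1 : 0 ≤ (1 - θ) ^ α := Real.rpow_nonneg (by linarith [h.2]) _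
    have n2 : 0 ≤ θ ^ β := Real.rpow_nonneg h.1.le _
    simp only [Pi.add_apply]
    rw [Real.norm_of_nonneg (mul_nonneg n1 n2)]
    rcases le_total θ (1/2) with c | c
    · have := half_rpow_le hα0 hα (x := 1 - θ) (by linarith)
      nlinarith
    · have := half_rpow_le hβ0 hβ c
      nlinarith

lemma cont_bdd {f : ℝ → ℝ} (hf : ContinuousOn f (Icc 0 1)) :
    ∃ B, 0 ≤ B ∧ ∀ x ∈ Icc (0:ℝ) 1, |f x| ≤ B := by
  obtain ⟨B, hB⟩ := isCompact_Icc.exists_bound_of_continuousOn hf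
  exact ⟨B, (norm_nonneg _).trans (hB 0 (by simp)), fun x hx => hB x hx⟩

section
variable {α β : ℝ} (hα0 : -1 < α) (hα : α ≤ 0) (hβ0 : -1 < β) (hβ : β ≤ 0)

lemma mulw_integrable (hα0 : -1 < α) (hα : α ≤ 0) (hβ0 : -1 < β) (hβ : β ≤ 0)
    {f : ℝ → ℝ} (hf : ContinuousOn f (Icc 0 1)) :
    IntegrableOn (fun θ : ℝ => f θ * ((1 - θ) ^ α * θ ^ β)) (Ioo 0 1) := by
  obtain ⟨B, -, hB⟩ := cont_bdd hf
  refine Integrable.bdd_mul (c := B) (jw_integrable hα0 hα hβ0 hβ) ?_ ?_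
  · exact (hf.mono Ioo_subset_Icc_self).aestronglyMeasurable measurableSet_Ioo
  · exact (ae_restrict_iff' measurableSet_Ioo).2
      (Filter.Eventually.of_forall fun x hx => hB x (Ioo_subset_Icc_self hx))

lemma w_nonneg {θ : ℝ} (h : θ ∈ Ioo (0:ℝ) 1) : 0 ≤ (1 - θ) ^ α * θ ^ β :=
  mul_nonneg (Real.rpow_nonneg (by linarith [h.2]) _) (Real.rpow_nonneg h.1.le _)

lemma N_nonneg (f : ℝ → ℝ) : 0 ≤ jacobiL2Norm α β f := Real.sqrt_nonneg _

lemma N_sq (f : ℝ → ℝ) : jacobiL2Norm α β f ^ 2 =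
    ∫ θ in Set.Ioo (0:ℝ) 1, f θ ^ 2 * ((1 - θ) ^ α * θ ^ β) :=
  Real.sq_sqrt (setIntegral_nonneg measurableSet_Ioo fun x hx =>
    mul_nonneg (sq_nonneg _) (w_nonneg hx))

lemma N_tri (hα0 : -1 < α) (hα : α ≤ 0) (hβ0 : -1 < β) (hβ : β ≤ 0)
    {f g h : ℝ → ℝ} (hf : ContinuousOn f (Icc 0 1))
    (hg : ContinuousOn g (Icc 0 1)) (hh : ContinuousOn h (Icc 0 1))
    (hle : ∀ x ∈ Icc (0:ℝ) 1, |f x| ≤ |g x| + |h x|) :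
    jacobiL2Norm α β f ≤ 2 * (jacobiL2Norm α β g + jacobiL2Norm α β h) := by
  have ig := mulw_integrable hα0 hα hβ0 hβ (hg.pow 2)
  have ih := mulw_integrable hα0 hα hβ0 hβ (hh.pow 2)
  have i := mulw_integrable hα0 hα hβ0 hβ (hf.pow 2)
  simp only [Pi.pow_apply] at ig ih i
  have key : jacobiL2Norm α β f ^ 2 ≤
      2 * jacobiL2Norm α β g ^ 2 + 2 * jacobiL2Norm α β h ^ 2 := by
    rw [N_sq, N_sq, N_sq, ← MeasureTheory.integral_const_mul, ← MeasureTheory.integral_const_mul,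
      ← MeasureTheory.integral_add (ig.const_mul 2) (ih.const_mul 2)]
    refine setIntegral_mono_on i ((ig.const_mul 2).add (ih.const_mul 2)) measurableSet_Ioo ?_
    intro x hx
    have hw := w_nonneg (α := α) (β := β) hx
    have h1 := hle x (Ioo_subset_Icc_self hx)
    have : f x ^ 2 ≤ 2 * g x ^ 2 + 2 * h x ^ 2 := by
      rw [← sq_abs (f x), ← sq_abs (g x), ← sq_abs (h x)]
      nlinarith [abs_nonneg (f x), abs_nonneg (g x), abs_nonneg (h x), sq_nonneg (|g x| - |h x|)]
    calc f x ^ 2 * ((1 - x) ^ α * x ^ β) ≤ (2 * g x ^ 2 + 2 * h x ^ 2) * ((1 - x) ^ α * x ^ β) :=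
          mul_le_mul_of_nonneg_right this hw
      _ = _ := by ring
  refine abs_le_of_sq_le_sq' ?_ (by have := N_nonneg (α := α) (β := β) g; have := N_nonneg (α := α) (β := β) h; positivity) |>.2
  have := N_nonneg (α := α) (β := β) g
  have := N_nonneg (α := α) (β := β) h
  nlinarith [mul_nonneg (N_nonneg (α := α) (β := β) g) (N_nonneg (α := α) (β := β) h), sq_nonneg (jacobiL2Norm α β g), sq_nonneg (jacobiL2Norm α β h)]

lemma N_const {c : ℝ} (hc : 0 ≤ c) :
    jacobiL2Norm α β (fun _ => c) = c * jacobiL2Norm α β (fun _ => 1) := by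
  unfold jacobiL2Norm
  rw [MeasureTheory.integral_const_mul, Real.sqrt_mul (sq_nonneg c), Real.sqrt_sq hc]
  simp

lemma L1_le_N (hα0 : -1 < α) (hα : α ≤ 0) (hβ0 : -1 < β) (hβ : β ≤ 0)
    {f : ℝ → ℝ} (hf : ContinuousOn f (Icc 0 1)) :
    (∫ x in (0:ℝ)..1, |f x|) ≤ jacobiL2Norm α β f := by
  have iw := mulw_integrable hα0 hα hβ0 hβ (hf.pow 2)
  have i1 : IntegrableOn (fun x => |f x|) (Ioo 0 1) :=
    (hf.abs.integrableOn_compact isCompact_Icc).mono_set Ioo_subset_Icc_self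
  have i2 : IntegrableOn (fun x => f x ^ 2) (Ioo 0 1) :=
    ((hf.pow 2).integrableOn_compact isCompact_Icc).mono_set Ioo_subset_Icc_self
  rw [intervalIntegral.integral_of_le zero_le_one, integral_Ioc_eq_integral_Ioo]
  set m := ∫ x in Ioo (0:ℝ) 1, |f x| with hm
  refine abs_le_of_sq_le_sq' ?_ (N_nonneg _) |>.2
  have h1 : (∫ x in Ioo (0:ℝ) 1, f x ^ 2) ≤ jacobiL2Norm α β f ^ 2 := by
    rw [N_sq]
    refine setIntegral_mono_on i2 iw measurableSet_Ioo fun x hx => ?_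
    exact le_mul_of_one_le_right (sq_nonneg _) (jw_one_le hα hβ hx)
  have h2 : (∫ x in Ioo (0:ℝ) 1, (2 * m) * |f x|) ≤ ∫ x in Ioo (0:ℝ) 1, (f x ^ 2 + m ^ 2) := by
    refine setIntegral_mono_on (i1.const_mul _) (i2.add (integrableOn_const (by simp)))
      measurableSet_Ioo fun x hx => ?_
    nlinarith [sq_nonneg (|f x| - m), sq_abs (f x)]
  rw [MeasureTheory.integral_const_mul, MeasureTheory.integral_add i2 (integrableOn_const (by simp))] at h2
  simp at h2
  rw [← hm] at h2
  nlinarith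
end

lemma sing_bound {μ γ θ B : ℝ} (hμ1 : μ < 1) (hμγ : 1 ≤ μ + γ) (hθ : 0 < θ)
    (h : ℝ → ℝ) (hB : ∀ η ∈ Ioc 0 θ, |h η| ≤ B) :
    |θ ^ (-γ) * (∫ η in (0:ℝ)..θ, (θ - η) ^ (-μ) * η ^ (μ + γ - 1) * h η)| ≤ B / (1 - μ) := by
  have hi := sub_rpow_intervalIntegrable (a := -μ) (t := θ) (by linarith)
  have e1 : (∫ η in (0:ℝ)..θ, (θ - η) ^ (-μ)) = θ ^ (1 - μ) / (1 - μ) := by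
    rw [intervalIntegral.integral_comp_sub_left (fun x => x ^ (-μ))]
    rw [integral_rpow (Or.inl (by linarith))]
    simp only [sub_self, sub_zero]
    rw [Real.zero_rpow (by linarith)]
    ring_nf
  have := intervalIntegral.norm_integral_le_of_norm_le (μ := volume) hθ.le
    (f := fun η => (θ - η) ^ (-μ) * η ^ (μ + γ - 1) * h η)
    (g := fun η => (θ ^ (μ + γ - 1) * B) * (θ - η) ^ (-μ))
    (Filter.Eventually.of_forall ?_) (hi.const_mul _)
  · rw [intervalIntegral.integral_const_mul, e1] at this
    rw [abs_mul, abs_of_nonneg (Real.rpow_nonneg hθ.le _)]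
    calc _ ≤ θ ^ (-γ) * (θ ^ (μ + γ - 1) * B * (θ ^ (1 - μ) / (1 - μ))) :=
          mul_le_mul_of_nonneg_left this (Real.rpow_nonneg hθ.le _)
      _ = (θ ^ (-γ) * θ ^ (μ + γ - 1) * θ ^ (1 - μ)) * (B / (1 - μ)) := by ring
      _ = B / (1 - μ) := by
          rw [← Real.rpow_add hθ, ← Real.rpow_add hθ]
          rw [show -γ + (μ + γ - 1) + (1 - μ) = 0 by ring]; simp
  · intro η hη
    have n1 : 0 ≤ (θ - η) ^ (-μ) := Real.rpow_nonneg (by linarith [hη.2]) _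
    have n2 : 0 ≤ η ^ (μ + γ - 1) := Real.rpow_nonneg hη.1.le _
    have n3 : η ^ (μ + γ - 1) ≤ θ ^ (μ + γ - 1) :=
      Real.rpow_le_rpow hη.1.le hη.2 (by linarith)
    rw [Real.norm_eq_abs, abs_mul, abs_mul, abs_of_nonneg n1, abs_of_nonneg n2]
    calc _ = η ^ (μ + γ - 1) * |h η| * (θ - η) ^ (-μ) := by ring
      _ ≤ _ := by
        refine mul_le_mul_of_nonneg_right ?_ n1
        exact mul_le_mul n3 (hB η hη) (abs_nonneg _) (n2.trans n3)

lemma ii {f : ℝ → ℝ} (hf : ContinuousOn f (Icc 0 1)) {a b : ℝ} (ha : a ∈ Icc (0:ℝ) 1)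
    (hb : b ∈ Icc (0:ℝ) 1) : IntervalIntegrable f volume a b :=
  (hf.mono (by rw [← uIcc_of_le zero_le_one] at *; exact uIcc_subset_uIcc ha hb)).intervalIntegrable

lemma prim_cont {f : ℝ → ℝ} (hf : ContinuousOn f (Icc 0 1)) :
    ContinuousOn (fun t => ∫ x in (0:ℝ)..t, f x) (Icc 0 1) :=
  by simpa using (intervalIntegral.continuousOn_primitive_interval (μ := volume) (a := (0:ℝ)) (b := 1)
    (by rw [uIcc_of_le zero_le_one]; exact hf.integrableOn_compact isCompact_Icc))

lemma prim_deriv {f : ℝ → ℝ} (hf : ContinuousOn f (Icc 0 1)) {t : ℝ} (ht : t ∈ Ioo (0:ℝ) 1) :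
    HasDerivAt (fun t => ∫ x in (0:ℝ)..t, f x) (f t) t := by
  have hn : Icc (0:ℝ) 1 ∈ nhds t := Icc_mem_nhds ht.1 ht.2
  refine intervalIntegral.integral_hasDerivAt_right (ii hf (by simp) (Ioo_subset_Icc_self ht)) ?_
    (hf.continuousAt hn)
  exact (hf.mono Ioo_subset_Icc_self).stronglyMeasurableAtFilter isOpen_Ioo t ht

lemma prim_mono {f : ℝ → ℝ} (hf : ContinuousOn f (Icc 0 1)) (h0 : ∀ x ∈ Icc (0:ℝ) 1, 0 ≤ f x)
    {s t : ℝ} (hs : 0 ≤ s) (hst : s ≤ t) (ht : t ≤ 1) :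
    (∫ x in (0:ℝ)..s, f x) ≤ ∫ x in (0:ℝ)..t, f x := by
  rw [← intervalIntegral.integral_add_adjacent_intervals
    (ii hf (by simp) ⟨hs, hst.trans ht⟩) (ii hf ⟨hs, hst.trans ht⟩ ⟨hs.trans hst, ht⟩)]
  have : 0 ≤ ∫ x in s..t, f x :=
    intervalIntegral.integral_nonneg hst fun x hx => h0 x ⟨hs.trans hx.1, hx.2.trans ht⟩
  linarith

lemma gron {u g : ℝ → ℝ} {M : ℝ} (hM : 0 ≤ M) (hu : ContinuousOn u (Icc 0 1))
    (hg : ContinuousOn g (Icc 0 1)) (hg0 : ∀ x ∈ Icc (0:ℝ) 1, 0 ≤ g x)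
    (h : ∀ t ∈ Ioc (0:ℝ) 1, u t ≤ M * (∫ x in (0:ℝ)..t, u x) + g t) :
    (∫ x in (0:ℝ)..1, u x) ≤ Real.exp M * ∫ x in (0:ℝ)..1, g x := by
  have anti : AntitoneOn (fun t => Real.exp (-(M * t)) * (∫ x in (0:ℝ)..t, u x)
      - ∫ x in (0:ℝ)..t, g x) (Icc 0 1) := by
    have hd : ∀ t ∈ Ioo (0:ℝ) 1, HasDerivAt (fun t => Real.exp (-(M * t)) * (∫ x in (0:ℝ)..t, u x)
      - ∫ x in (0:ℝ)..t, g x) (Real.exp (-(M * t)) * (u t - M * ∫ x in (0:ℝ)..t, u x) - g t) t := by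
      intro t ht
      have he : HasDerivAt (fun t => Real.exp (-(M * t))) (Real.exp (-(M * t)) * (-(M * 1))) t :=
        (((hasDerivAt_id t).const_mul M).neg).exp
      exact ((he.mul (prim_deriv hu ht)).sub (prim_deriv hg ht)).congr_deriv (by ring)
    refine antitoneOn_of_deriv_nonpos (convex_Icc 0 1) ?_ ?_ ?_
    · exact (((by fun_prop : Continuous fun t => Real.exp (-(M * t))).continuousOn).mul
        (prim_cont hu)).sub (prim_cont hg)
    · rw [interior_Icc]
      exact fun t ht => (hd t ht).differentiableAt.differentiableWithinAt
    · rw [interior_Icc]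
      intro t ht
      rw [(hd t ht).deriv]
      have h1 := h t ⟨ht.1, ht.2.le⟩
      have h2 := hg0 t (Ioo_subset_Icc_self ht)
      have h3 : Real.exp (-(M * t)) ≤ 1 := Real.exp_le_one_iff.2 (by nlinarith [ht.1])
      have h4 := Real.exp_pos (-(M * t))
      have : Real.exp (-(M * t)) * (u t - M * ∫ x in (0:ℝ)..t, u x) ≤ Real.exp (-(M * t)) * g t :=
        mul_le_mul_of_nonneg_left (by linarith) h4.le
      nlinarith
  have := anti (by simp : (0:ℝ) ∈ Icc (0:ℝ) 1) (by simp : (1:ℝ) ∈ Icc (0:ℝ) 1) zero_le_one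
  simp at this
  calc (∫ x in (0:ℝ)..1, u x) = Real.exp M * (Real.exp (-M) * ∫ x in (0:ℝ)..1, u x) := by
        rw [← mul_assoc, ← Real.exp_add]; simp
    _ ≤ _ := mul_le_mul_of_nonneg_left this (Real.exp_pos _).le

lemma le_sup {f : ℝ → ℝ} (hf : ContinuousOn f (Icc 0 1)) {x : ℝ} (hx : x ∈ Icc (0:ℝ) 1) :
    |f x| ≤ ⨆ θ ∈ Icc (0:ℝ) 1, |f θ| := by
  obtain ⟨B, hB0, hB⟩ := cont_bdd hf
  have hb : BddAbove (range fun θ => ⨆ (_ : θ ∈ Icc (0:ℝ) 1), |f θ|) := by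
    refine ⟨B, ?_⟩
    rintro _ ⟨y, rfl⟩
    exact Real.iSup_le (fun hy => hB y hy) hB0
  refine le_trans ?_ (le_ciSup hb x)
  simp [hx.1, hx.2]

lemma tri_bdd {K : ℝ → ℝ → ℝ} (hK : ContinuousOn (fun p : ℝ × ℝ => K p.1 p.2)
      {p : ℝ × ℝ | 0 ≤ p.2 ∧ p.2 ≤ p.1 ∧ p.1 ≤ 1}) :
    ∃ B, 0 ≤ B ∧ ∀ x y, 0 ≤ y → y ≤ x → x ≤ 1 → |K x y| ≤ B := by
  have hc : IsCompact {p : ℝ × ℝ | 0 ≤ p.2 ∧ p.2 ≤ p.1 ∧ p.1 ≤ 1} := by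
    refine (isCompact_Icc (a := ((0:ℝ),(0:ℝ))) (b := ((1:ℝ),(1:ℝ)))).of_isClosed_subset ?_ ?_
    · exact (isClosed_le continuous_const continuous_snd).inter
        ((isClosed_le continuous_snd continuous_fst).inter
          (isClosed_le continuous_fst continuous_const))
    · rintro ⟨x, y⟩ ⟨h1, h2, h3⟩
      simp only at h1 h2 h3
      exact ⟨⟨h1.trans h2, h1⟩, ⟨h3, h2.trans h3⟩⟩
  obtain ⟨B, hB⟩ := hc.exists_bound_of_continuousOn hK
  refine ⟨B, (norm_nonneg _).trans (hB (0,0) (by simp)), fun x y h1 h2 h3 => hB (x, y) ⟨h1, h2, h3⟩⟩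

set_option maxHeartbeats 1000000 in
/-- Abstract error-propagation theorem (weighted-`L²` form) of the convergence
analysis: if the errors `e*`, `e` satisfy the displayed identity with consistency
error terms `E₁, …, E₉`, then `‖e*‖_{L²_w} ≤ C (Σ_{p=1}^{9} ‖E_p‖_{L²_w} + sup |E₈|
+ sup |E₉|)` and `‖e‖_{L²_w} ≤ C (‖e*‖_{L²_w} + ‖E₈‖_{L²_w} + ‖E₉‖_{L²_w})`, with `C`
independent of `e*, e, E₁, …, E₉`. -/
theorem error_propagation_weighted_L2
    (μ γ ε α β : ℝ) (hμ0 : 0 ≤ μ) (hμ1 : μ < 1) (hγ : 0 < γ) (hμγ : 1 ≤ μ + γ)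
    (hε0 : 0 < ε) (hε1 : ε ≤ 1)
    (hα0 : -1 < α) (hα1 : α ≤ -(1/2)) (hβ0 : -1 < β) (hβ1 : β ≤ -(1/2))
    (p₁ q₁ : ℝ → ℝ) (K₁ K₂ : ℝ → ℝ → ℝ)
    (hp : ContinuousOn p₁ (Icc 0 1)) (hq : ContinuousOn q₁ (Icc 0 1))
    (hK₁ : ContinuousOn (fun p : ℝ × ℝ => K₁ p.1 p.2)
      {p : ℝ × ℝ | 0 ≤ p.2 ∧ p.2 ≤ p.1 ∧ p.1 ≤ 1})
    (hK₂ : ContinuousOn (fun p : ℝ × ℝ => K₂ p.1 p.2)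
      {p : ℝ × ℝ | 0 ≤ p.2 ∧ p.2 ≤ p.1 ∧ p.1 ≤ 1}) :
    ∃ C > 0, ∀ estar e E1 E2 E3 E4 E5 E6 E7 E8 E9 : ℝ → ℝ,
      ContinuousOn estar (Icc 0 1) →
      ContinuousOn E1 (Icc 0 1) → ContinuousOn E2 (Icc 0 1) →
      ContinuousOn E3 (Icc 0 1) → ContinuousOn E4 (Icc 0 1) →
      ContinuousOn E5 (Icc 0 1) → ContinuousOn E6 (Icc 0 1) →
      ContinuousOn E7 (Icc 0 1) → ContinuousOn E8 (Icc 0 1) →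
      ContinuousOn E9 (Icc 0 1) →
      (∀ θ, e θ = (∫ η in (0:ℝ)..θ, estar η) + E8 θ + E9 θ) →
      (∀ θ ∈ Ioc (0:ℝ) 1, estar θ =
        p₁ θ * (∫ η in (0:ℝ)..θ, estar η)
        + ε * q₁ θ * (∫ η in (0:ℝ)..θ, estar (ε * η))
        + θ ^ (-γ) * (∫ η in (0:ℝ)..θ,
            (θ - η) ^ (-μ) * η ^ (μ + γ - 1) * K₁ θ η * e η)
        + θ ^ (-γ) * (∫ η in (0:ℝ)..θ,
            (θ - η) ^ (-μ) * η ^ (μ + γ - 1) * K₂ θ (ε * η) * e (ε * η))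
        + (E1 θ + E2 θ + E3 θ + E4 θ + E5 θ + E6 θ + E7 θ)) →
      jacobiL2Norm α β estar ≤ C *
          (jacobiL2Norm α β E1 + jacobiL2Norm α β E2 + jacobiL2Norm α β E3
            + jacobiL2Norm α β E4 + jacobiL2Norm α β E5 + jacobiL2Norm α β E6
            + jacobiL2Norm α β E7 + jacobiL2Norm α β E8 + jacobiL2Norm α β E9
            + (⨆ θ ∈ Icc (0:ℝ) 1, |E8 θ|) + (⨆ θ ∈ Icc (0:ℝ) 1, |E9 θ|))
      ∧ jacobiL2Norm α β e ≤ C *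
          (jacobiL2Norm α β estar + jacobiL2Norm α β E8 + jacobiL2Norm α β E9) := by
  have hα : α ≤ 0 := by linarith
  have hβ : β ≤ 0 := by linarith
  obtain ⟨P, hP0, hP⟩ := cont_bdd hp
  obtain ⟨Q, hQ0, hQ⟩ := cont_bdd hq
  obtain ⟨A, hA0, hA⟩ := tri_bdd hK₁
  obtain ⟨B, hB0, hB⟩ := tri_bdd hK₂
  have hm : 0 < 1 - μ := by linarith
  obtain ⟨M, hMdef⟩ : ∃ M, M = P + Q + A / (1 - μ) + B / (1 - μ) := ⟨_, rfl⟩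
  have hM : 0 ≤ M := by rw [hMdef]; positivity
  obtain ⟨W, hWdef⟩ : ∃ W, W = jacobiL2Norm α β (fun _ => (1:ℝ)) := ⟨_, rfl⟩
  have hW : 0 ≤ W := hWdef ▸ N_nonneg _
  obtain ⟨X, hXdef⟩ : ∃ X, X = Real.exp M := ⟨_, rfl⟩
  have hX : 0 < X := hXdef ▸ Real.exp_pos M
  -- constants
  refine ⟨2 * W * (M * X * (M + 128) + M) + 256 + 2 * W + 4, by positivity, ?_⟩
  intro u e E1 E2 E3 E4 E5 E6 E7 E8 E9 hu h1 h2 h3 h4 h5 h6 h7 h8 h9 he hid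
  set S8 := ⨆ θ ∈ Icc (0:ℝ) 1, |E8 θ| with hS8
  set S9 := ⨆ θ ∈ Icc (0:ℝ) 1, |E9 θ| with hS9
  have z : (0:ℝ) ∈ Icc (0:ℝ) 1 := by simp
  have o : (1:ℝ) ∈ Icc (0:ℝ) 1 := by simp
  have l8 : ∀ x ∈ Icc (0:ℝ) 1, |E8 x| ≤ S8 := fun x hx => le_sup h8 hx
  have l9 : ∀ x ∈ Icc (0:ℝ) 1, |E9 x| ≤ S9 := fun x hx => le_sup h9 hx
  have p8 : 0 ≤ S8 := (abs_nonneg _).trans (l8 0 z)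
  have p9 : 0 ≤ S9 := (abs_nonneg _).trans (l9 0 z)
  clear_value S8 S9
  obtain ⟨S, hS⟩ : ∃ S, S = S8 + S9 := ⟨_, rfl⟩
  have hS0 : 0 ≤ S := by rw [hS]; positivity
  have hua : ContinuousOn (fun x => |u x|) (Icc 0 1) := hu.abs
  have hua0 : ∀ x ∈ Icc (0:ℝ) 1, 0 ≤ |u x| := fun x _ => abs_nonneg _
  obtain ⟨U, hU⟩ : ∃ U : ℝ → ℝ, U = fun t => ∫ x in (0:ℝ)..t, |u x| := ⟨_, rfl⟩
  have Umono : ∀ s t, 0 ≤ s → s ≤ t → t ≤ 1 → U s ≤ U t := by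
    intro s t a b c; rw [hU]; exact prim_mono hua hua0 a b c
  have U0 : ∀ t, 0 ≤ t → t ≤ 1 → 0 ≤ U t := by
    intro t a b
    have := Umono 0 t le_rfl a b
    rw [hU] at this ⊢; simpa using this
  have Iu : ∀ t, 0 ≤ t → |∫ x in (0:ℝ)..t, u x| ≤ U t := by
    intro t a; rw [hU]; exact intervalIntegral.abs_integral_le_integral_abs a
  have eb : ∀ s t, 0 ≤ s → s ≤ t → t ≤ 1 → |e s| ≤ U t + S := by
    intro s t a b c
    rw [he s, hS]
    have := Iu s a
    have := Umono s t a b c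
    have := l8 s ⟨a, b.trans c⟩
    have := l9 s ⟨a, b.trans c⟩
    have := abs_add_three (∫ x in (0:ℝ)..s, u x) (E8 s) (E9 s)
    linarith
  obtain ⟨F, hF⟩ : ∃ F : ℝ → ℝ, F = fun θ =>
    E1 θ + E2 θ + E3 θ + E4 θ + E5 θ + E6 θ + E7 θ := ⟨_, rfl⟩
  have hFc : ContinuousOn F (Icc 0 1) := by
    rw [hF]; exact (((((h1.add h2).add h3).add h4).add h5).add h6).add h7
  -- pointwise bound
  have pw : ∀ t ∈ Ioc (0:ℝ) 1, |u t| ≤ M * U t + (M * S + |F t|) := by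
    intro t ht
    have htI : t ∈ Icc (0:ℝ) 1 := Ioc_subset_Icc_self ht
    have hUt := U0 t ht.1.le ht.2
    have t1 : |p₁ t * (∫ η in (0:ℝ)..t, u η)| ≤ P * U t := by
      rw [abs_mul]; exact mul_le_mul (hP t htI) (Iu t ht.1.le) (abs_nonneg _) hP0
    have t2 : |ε * q₁ t * (∫ η in (0:ℝ)..t, u (ε * η))| ≤ Q * U t := by
      have : ε * q₁ t * (∫ η in (0:ℝ)..t, u (ε * η)) = q₁ t * ∫ η in (0:ℝ)..(ε * t), u η := by
        rw [intervalIntegral.integral_comp_mul_left _ hε0.ne']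
        simp only [mul_zero, smul_eq_mul]
        field_simp
      rw [this, abs_mul]
      have a : 0 ≤ ε * t := mul_nonneg hε0.le ht.1.le
      have b : ε * t ≤ t := by nlinarith [ht.1]
      exact mul_le_mul (hQ t htI) ((Iu _ a).trans (Umono _ _ a b ht.2)) (abs_nonneg _) hQ0
    have t3 := sing_bound (B := A * (U t + S)) hμ1 hμγ ht.1 (fun η => K₁ t η * e η) (by
      intro η hη
      rw [abs_mul]
      exact mul_le_mul (hA t η hη.1.le hη.2 ht.2) (eb η t hη.1.le hη.2 ht.2) (abs_nonneg _) hA0)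
    have t4 := sing_bound (B := B * (U t + S)) hμ1 hμγ ht.1
      (fun η => K₂ t (ε * η) * e (ε * η)) (by
      intro η hη
      have a : 0 ≤ ε * η := mul_nonneg hε0.le hη.1.le
      have b : ε * η ≤ t := by nlinarith [hη.1, hη.2]
      rw [abs_mul]
      exact mul_le_mul (hB t _ a b ht.2) (eb _ t a b ht.2) (abs_nonneg _) hB0)
    simp only [← mul_assoc] at t3 t4
    have key := hid t ht
    have hFt : F t = E1 t + E2 t + E3 t + E4 t + E5 t + E6 t + E7 t := by rw [hF]
    rw [← hFt] at key
    rw [key]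
    refine (abs_add_le _ _).trans ?_
    refine (add_le_add_left ((abs_add_le _ _).trans (add_le_add_left ((abs_add_le _ _).trans
      (add_le_add_left (abs_add_le _ _) _)) _)) _).trans ?_
    have hx : 0 ≤ (P + Q) * S := by positivity
    have : M * U t + M * S = P * U t + Q * U t + A * (U t + S) / (1 - μ) + B * (U t + S) / (1 - μ)
      + (P + Q) * S := by rw [hMdef]; ring
    linarith
  have hgc : ContinuousOn (fun t => M * S + |F t|) (Icc 0 1) := continuousOn_const.add hFc.abs
  have g1 : U 1 ≤ X * ∫ x in (0:ℝ)..1, (M * S + |F x|) := by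
    rw [hU, hXdef]
    refine gron hM hua hgc (fun x _ => by positivity) ?_
    intro t ht
    have := pw t ht
    rw [hU] at this
    exact this
  rw [intervalIntegral.integral_add (by simp) (ii hFc.abs z o)] at g1
  simp only [intervalIntegral.integral_const, sub_zero, one_smul] at g1
  have NF := L1_le_N hα0 hα hβ0 hβ hFc
  set N := jacobiL2Norm α β with hN
  have n0 : ∀ f, 0 ≤ N f := fun f => N_nonneg f
  have tri : ∀ f g h : ℝ → ℝ, ContinuousOn f (Icc 0 1) → ContinuousOn g (Icc 0 1) →
      ContinuousOn h (Icc 0 1) → (∀ x ∈ Icc (0:ℝ) 1, |f x| ≤ |g x| + |h x|) →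
      N f ≤ 2 * (N g + N h) := fun f g h a b c d => N_tri hα0 hα hβ0 hβ a b c d
  have addt : ∀ g h : ℝ → ℝ, ContinuousOn g (Icc 0 1) →
      ContinuousOn h (Icc 0 1) → N (fun x => g x + h x) ≤ 2 * (N g + N h) :=
    fun g h b c => tri _ g h (b.add c) b c fun x _ => abs_add_le _ _
  have NFle : N F ≤ 128 * (N E1 + N E2 + N E3 + N E4 + N E5 + N E6 + N E7) := by
    have c2 := h1.add h2
    have c3 := c2.add h3
    have c4 := c3.add h4
    have c5 := c4.add h5
    have c6 := c5.add h6
    have a2 := addt _ _ h1 h2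
    have a3 := addt _ _ c2 h3
    have a4 := addt _ _ c3 h4
    have a5 := addt _ _ c4 h5
    have a6 := addt _ _ c5 h6
    have a7 := addt _ _ c6 h7
    simp only [Pi.add_apply] at a2 a3 a4 a5 a6 a7
    rw [hF]
    have := n0 E1; have := n0 E2; have := n0 E3; have := n0 E4
    have := n0 E5; have := n0 E6; have := n0 E7
    simp only [Pi.add_def] at *
    linarith
  have hU1 := U0 1 zero_le_one le_rfl
  have NU : U 1 ≤ N u := by rw [hU]; exact L1_le_N hα0 hα hβ0 hβ hu
  have Nc : ∀ c : ℝ, 0 ≤ c → N (fun _ => c) = c * W := by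
    intro c hc; rw [hWdef]; exact N_const hc
  have q1 := n0 E1; have q2 := n0 E2; have q3 := n0 E3; have q4 := n0 E4
  have q5 := n0 E5; have q6 := n0 E6; have q7 := n0 E7; have q8 := n0 E8; have q9 := n0 E9
  have qu := n0 u
  constructor
  · have hle : ∀ x ∈ Icc (0:ℝ) 1, |u x| ≤ |M * U 1 + M * S| + |F x| := by
      have hcl : IsClosed {x ∈ Icc (0:ℝ) 1 | |u x| ≤ |M * U 1 + M * S| + |F x|} :=
        isClosed_Icc.isClosed_le hua (continuousOn_const.add hFc.abs)
      have hsub : Ioc (0:ℝ) 1 ⊆ {x ∈ Icc (0:ℝ) 1 | |u x| ≤ |M * U 1 + M * S| + |F x|} := by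
        intro x hx
        refine ⟨Ioc_subset_Icc_self hx, ?_⟩
        have := pw x hx
        have := mul_le_mul_of_nonneg_left (Umono x 1 hx.1.le hx.2 le_rfl) hM
        have := le_abs_self (M * U 1 + M * S)
        linarith
      intro x hx
      have := closure_minimal hsub hcl
      rw [closure_Ioc zero_ne_one] at this
      exact (this hx).2
    have r := tri u (fun _ => M * U 1 + M * S) F hu continuousOn_const hFc hle
    rw [Nc _ (by positivity)] at r
    obtain ⟨T, hT⟩ : ∃ T, T = N E1 + N E2 + N E3 + N E4 + N E5 + N E6 + N E7 + N E8 + N E9 + S8 + S9 :=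
      ⟨_, rfl⟩
    rw [← hT]
    have hT0 : 0 ≤ T := by rw [hT]; positivity
    have b1 : N F ≤ 128 * T := by rw [hT]; linarith
    have b2 : S ≤ T := by rw [hT, hS]; linarith
    have b3 : U 1 ≤ X * (M * T + 128 * T) :=
      g1.trans (mul_le_mul_of_nonneg_left (by nlinarith) hX.le)
    have b4 : (M * U 1 + M * S) * W ≤ (M * (X * (M * T + 128 * T)) + M * T) * W := by gcongr
    have b5 : 0 ≤ W * T := by positivity
    calc N u ≤ 2 * ((M * (X * (M * T + 128 * T)) + M * T) * W + 128 * T) := by linarith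
      _ ≤ _ := by
        have e1 : (2 * W * (M * X * (M + 128) + M) + 256 + 2 * W + 4) * T =
          2 * ((M * (X * (M * T + 128 * T)) + M * T) * W + 128 * T) + (2 * (W * T) + 4 * T) := by
          ring
        rw [e1]
        linarith
  · have hec : ContinuousOn e (Icc 0 1) := by
      rw [show e = fun θ => (∫ η in (0:ℝ)..θ, u η) + E8 θ + E9 θ from funext he]
      exact ((prim_cont hu).add h8).add h9
    have r := tri e (fun _ => U 1) (fun x => |E8 x| + |E9 x|) hec continuousOn_const
      (h8.abs.add h9.abs) (by
        intro x hx
        rw [he x, abs_of_nonneg hU1, abs_of_nonneg (by positivity : 0 ≤ |E8 x| + |E9 x|)]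
        have := Iu x hx.1
        have := Umono x 1 hx.1 hx.2 le_rfl
        have := abs_add_three (∫ x in (0:ℝ)..x, u x) (E8 x) (E9 x)
        linarith)
    have r2 := tri (fun x => |E8 x| + |E9 x|) E8 E9 (h8.abs.add h9.abs) h8 h9 (by
        intro x hx
        rw [abs_of_nonneg (by positivity : 0 ≤ |E8 x| + |E9 x|)])
    rw [Nc _ hU1] at r
    have b1 : U 1 * W ≤ N u * W := mul_le_mul_of_nonneg_right NU hW
    have k : 0 ≤ 2 * W * (M * X * (M + 128) + M) + 256 := by positivity
    have s0 : 0 ≤ N u + N E8 + N E9 := by positivity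
    have k2 := mul_nonneg k s0
    have k3 : 0 ≤ W * (N E8 + N E9) := by positivity
    have e1 : (2 * W * (M * X * (M + 128) + M) + 256 + 2 * W + 4) * (N u + N E8 + N E9) =
      (2 * W * (M * X * (M + 128) + M) + 256) * (N u + N E8 + N E9) + 2 * (N u * W)
        + 2 * (W * (N E8 + N E9)) + 4 * (N u + N E8 + N E9) := by ring
    rw [e1]
    linarith
end
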